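/- Consider gradient flow on the square-loss deep linear training loss f starting from a balanced initial point θ_s ∈ ℝ^d whose end-to-end matrix W_{n:1,s} satisfies ‖W_{n:1,s}‖_F ∈ (0, 0.2], and assume ν := Tr(Λ_yxᵀ W_{n:1,s})/(‖Λ_yx‖_F·‖W_{n:1,s}‖_F) ≠ −1. Then (1) the gradient flow trajectory θ : [0,∞) → ℝ^d is defined over infinite time; (2) for every ε̄ > 0, at the time t̄ = (2n·(max{1, (3/2)·(1−ν)/(1+ν)})^n / ‖W_{n:1,s}‖_F) · ln( 15n·max{1, (1−ν)/(1+ν)} / (‖W_{n:1,s}‖_F·min{1, 2ε̄}) ) one has f(θ(t̄)) − min_{q∈ℝ^d} f(q) ≤ ε̄; and (3) for any t > 0 and ε ∈ (0, 1/(2n)], with D_{t,ε} := ∪_{t′∈[0,t]} B_ε(θ(t′)) (union of closed ε-balls around the trajectory), one has sup_{q∈D_{t,ε}} ‖∇²f(q)‖_spectral ≤ 16n, sup_{q∈D_{t,ε}} ‖∇f(q)‖₂ ≤ 6√n, and there exists a non-negative integrable function m : [0,t] → ℝ with −λ_min(∇²f(q)) ≤ m(t′) for all t′ ∈ [0,t]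 and q ∈ B_ε(θ(t′)), such that ∫₀ᵗ m(t′)dt′ ≤ 15n³·(max{1, (3/2)·(1−ν)/(1+ν)})^n·t·ε / ‖W_{n:1,s}‖_F + ln( n²·(e²·max{1, (1−ν)/(1+ν)})^{5(n−1)/2} / ‖W_{n:1,s}‖_F² ). -/

import Mathlib

open scoped RealInnerProductSpace
open Matrix

noncomputable section

/-- The family of weight matrices of a depth-`n` fully connected network with layer widths
`dims 0, dims 1, …, dims n`: `W j` maps `ℝ^{dims j}` to `ℝ^{dims (j+1)}` (zero-indexed). -/
abbrev WeightFam (n : ℕ) (dims : ℕ → ℕ) : Type :=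
  ∀ j : Fin n, Matrix (Fin (dims (j.val + 1))) (Fin (dims j.val)) ℝ

/-- Rectangular matrix with ones on the diagonal: equals the identity matrix whenever the
two dimensions coincide. -/
def castId (p q : ℕ) : Matrix (Fin p) (Fin q) ℝ :=
  Matrix.of fun i j => if (i : ℕ) = (j : ℕ) then 1 else 0

/-- `segProd dims W a b = W_{b-1} * ⋯ * W_a` (zero-indexed), the identity when `a = b`.
This realizes the paper's product `W_{b : a+1}` (one-indexed), empty products being
identity matrices. -/
def segProd {n : ℕ} (dims : ℕ → ℕ) (W : WeightFam n dims) (a : ℕ) :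
    (b : ℕ) → Matrix (Fin (dims b)) (Fin (dims a)) ℝ
  | 0 => castId (dims 0) (dims a)
  | b + 1 =>
      if a = b + 1 then castId (dims (b + 1)) (dims a)
      else if hb : b < n then W ⟨b, hb⟩ * segProd dims W a b else 0

/-- Frobenius norm of a matrix. -/
def frobNorm {p q : ℕ} (M : Matrix (Fin p) (Fin q) ℝ) : ℝ :=
  Real.sqrt (∑ i, ∑ j, M i j ^ 2)

/-- A weight setting is balanced when `W_{j+1}ᵀ W_{j+1} = W_j W_jᵀ` for all adjacent
pairs of layers. -/
def IsBalanced {n : ℕ} (dims : ℕ → ℕ) (W : WeightFam n dims) : Prop :=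
  ∀ (j : ℕ) (hj : j + 1 < n),
    (W ⟨j + 1, hj⟩)ᵀ * W ⟨j + 1, hj⟩ =
      W ⟨j, Nat.lt_of_succ_lt hj⟩ * (W ⟨j, Nat.lt_of_succ_lt hj⟩)ᵀ

/-- The Hessian of `f` at `x`, regarded as a quadratic form, evaluated at `v`. -/
def hessQ {E : Type*} [NormedAddCommGroup E] [InnerProductSpace ℝ E] [CompleteSpace E]
    (f : E → ℝ) (x v : E) : ℝ :=
  ⟪v, fderiv ℝ (gradient f) x v⟫

/-- The iterates of gradient descent with step size `η` started at `θ0`. -/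
def gdIter {E : Type*} [NormedAddCommGroup E] [InnerProductSpace ℝ E] [CompleteSpace E]
    (f : E → ℝ) (η : ℝ) (θ0 : E) : ℕ → E
  | 0 => θ0
  | k + 1 => gdIter f η θ0 k - η • gradient f (gdIter f η θ0 k)

section RadialFlow

open Real Set

/-- The solution of the second-order equation with second derivative equal to the function itself,
with value `1` and slope `ν` at the origin. -/
def flowCosh (ν x : ℝ) : ℝ := (1 + ν) / 2 * exp x + (1 - ν) / 2 * exp (-x)

/-- The derivative of `flowCosh ν`. -/
def flowSinh (ν x : ℝ) : ℝ := (1 + ν) / 2 * exp x - (1 - ν) / 2 * exp (-x)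

/-- The antiderivative of `n * flowCosh ν ^ n` with value `r⁻¹` at the origin. -/
def flowMass (n : ℕ) (r ν x : ℝ) : ℝ := r⁻¹ + n * ∫ y in (0 : ℝ)..x, flowCosh ν y ^ n

/-- The common norm of the layers, as a function of the rescaled time. -/
def flowScale (n : ℕ) (r ν x : ℝ) : ℝ :=
  flowCosh ν x * exp (-(log (flowMass n r ν x) / n))

/-- Squared distance between the end-to-end vector of norm `ρ` and the unit target, when the
cosine of the angle between them is `c`. -/
def sqDist (ρ c : ℝ) : ℝ := ρ ^ 2 - 2 * ρ * c + 1

lemma hasDerivAt_flowCosh (ν x : ℝ) : HasDerivAt (flowCosh ν) (flowSinh ν x) x := by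
  have h1 := (Real.hasDerivAt_exp x).const_mul ((1 + ν) / 2)
  have h2 := ((hasDerivAt_neg x).exp).const_mul ((1 - ν) / 2)
  refine (h1.add h2).congr_deriv ?_
  simp only [flowSinh]; ring

lemma hasDerivAt_flowSinh (ν x : ℝ) : HasDerivAt (flowSinh ν) (flowCosh ν x) x := by
  have h1 := (Real.hasDerivAt_exp x).const_mul ((1 + ν) / 2)
  have h2 := ((hasDerivAt_neg x).exp).const_mul ((1 - ν) / 2)
  refine (h1.sub h2).congr_deriv ?_
  simp only [flowCosh]; ring

lemma continuous_flowCosh (ν : ℝ) : Continuous (flowCosh ν) := by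
  unfold flowCosh; fun_prop

lemma flowCosh_zero (ν : ℝ) : flowCosh ν 0 = 1 := by simp [flowCosh]; ring

lemma flowSinh_zero (ν : ℝ) : flowSinh ν 0 = ν := by simp [flowSinh]; ring

lemma flowCosh_sq_sub (ν x : ℝ) : flowCosh ν x ^ 2 - flowSinh ν x ^ 2 = 1 - ν ^ 2 := by
  have : exp x * exp (-x) = 1 := by rw [← Real.exp_add]; simp
  simp only [flowCosh, flowSinh]
  linear_combination (1 - ν ^ 2) * this

variable {n : ℕ} {r ν : ℝ}

lemma flowCosh_pos (h1 : -1 < ν) (h2 : ν ≤ 1) (x : ℝ) : 0 < flowCosh ν x := by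
  have := Real.exp_pos x
  have h3 := Real.exp_pos (-x)
  have : 0 < (1 + ν) / 2 * exp x := by apply mul_pos <;> linarith
  have : 0 ≤ (1 - ν) / 2 * exp (-x) := by apply mul_nonneg <;> linarith
  unfold flowCosh; linarith

lemma flowSinh_le_flowCosh (h2 : ν ≤ 1) (x : ℝ) : flowSinh ν x ≤ flowCosh ν x := by
  have h3 := Real.exp_pos (-x)
  have : 0 ≤ (1 - ν) / 2 * exp (-x) := by apply mul_nonneg <;> linarith
  unfold flowCosh flowSinh; linarith

lemma le_flowCosh (h2 : ν ≤ 1) (x : ℝ) : (1 + ν) / 2 * exp x ≤ flowCosh ν x := by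
  have h3 := Real.exp_pos (-x)
  have : 0 ≤ (1 - ν) / 2 * exp (-x) := by apply mul_nonneg <;> linarith
  unfold flowCosh; linarith

lemma flowCosh_le_exp (h2 : ν ≤ 1) {x : ℝ} (hx : 0 ≤ x) : flowCosh ν x ≤ exp x := by
  have h3 : exp (-x) ≤ exp x := Real.exp_le_exp.2 (by linarith)
  unfold flowCosh
  nlinarith

lemma hasDerivAt_flowMass (n : ℕ) (r ν x : ℝ) :
    HasDerivAt (flowMass n r ν) (n * flowCosh ν x ^ n) x := by
  have hc : Continuous fun y => flowCosh ν y ^ n := (continuous_flowCosh ν).pow n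
  have := (hc.integral_hasStrictDerivAt 0 x).hasDerivAt
  exact (this.const_mul (n : ℝ)).const_add _

lemma flowMass_zero (n : ℕ) (r ν : ℝ) : flowMass n r ν 0 = r⁻¹ := by simp [flowMass]

lemma inv_le_flowMass (h1 : -1 < ν) (h2 : ν ≤ 1) {x : ℝ} (hx : 0 ≤ x) :
    r⁻¹ ≤ flowMass n r ν x := by
  have : 0 ≤ ∫ y in (0 : ℝ)..x, flowCosh ν y ^ n :=
    intervalIntegral.integral_nonneg hx fun y _ => (pow_pos (flowCosh_pos h1 h2 y) n).le
  unfold flowMass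
  have := mul_nonneg (Nat.cast_nonneg (α := ℝ) n) this
  linarith

lemma flowMass_pos (hr : 0 < r) (h1 : -1 < ν) (h2 : ν ≤ 1) {x : ℝ} (hx : 0 ≤ x) :
    0 < flowMass n r ν x := (inv_pos.2 hr).trans_le (inv_le_flowMass h1 h2 hx)

/-- Comparison of values via derivatives on a half-line. -/
lemma le_of_hasDerivAt_le {F G F' G' : ℝ → ℝ} {a x : ℝ} (hF : ∀ y ≥ a, HasDerivAt F (F' y) y)
    (hG : ∀ y ≥ a, HasDerivAt G (G' y) y) (hle : ∀ y ≥ a, F' y ≤ G' y) (h0 : F a ≤ G a)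
    (hx : a ≤ x) : F x ≤ G x := by
  have hm : MonotoneOn (fun y => G y - F y) (Ici a) := by
    apply monotoneOn_of_deriv_nonneg (convex_Ici a)
    · exact fun y hy => ((hG y hy).sub (hF y hy)).continuousAt.continuousWithinAt
    · intro y hy
      rw [interior_Ici] at hy
      exact ((hG y hy.le).sub (hF y hy.le)).differentiableAt.differentiableWithinAt
    · intro y hy
      rw [interior_Ici] at hy
      rw [((hG y hy.le).fun_sub (hF y hy.le)).deriv]
      linarith [hle y hy.le]
  have := hm (mem_Ici.2 le_rfl) (mem_Ici.2 hx) hx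
  simp only at this
  linarith

lemma flowCosh_pow_le_flowMass (hr : 0 < r) (hr1 : r ≤ 1) (h1 : -1 < ν) (h2 : ν ≤ 1) {x : ℝ}
    (hx : 0 ≤ x) : flowCosh ν x ^ n ≤ flowMass n r ν x := by
  refine le_of_hasDerivAt_le (a := 0) (F := fun x => flowCosh ν x ^ n)
    (fun y _ => (hasDerivAt_flowCosh ν y).pow n)
    (fun y _ => hasDerivAt_flowMass n r ν y) (fun y _ => ?_) ?_ hx
  · rcases Nat.eq_zero_or_pos n with rfl | hn
    · simp
    have : flowCosh ν y ^ n = flowCosh ν y ^ (n - 1) * flowCosh ν y := by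
      rw [← pow_succ, Nat.sub_add_cancel hn]
    rw [this, mul_assoc]
    have h := flowSinh_le_flowCosh h2 y
    have hp := (flowCosh_pos h1 h2 y).le
    gcongr
  · rw [flowMass_zero, flowCosh_zero, one_pow]
    exact (one_le_inv₀ hr).2 hr1

lemma exp_le_flowMass (hr : 0 < r) (hr1 : r ≤ 1) (h1 : -1 < ν) (h2 : ν ≤ 1) {x : ℝ}
    (hx : 0 ≤ x) : ((1 + ν) / 2 * exp x) ^ n ≤ flowMass n r ν x :=
  (pow_le_pow_left₀ (mul_nonneg (by linarith) (Real.exp_pos x).le) (le_flowCosh h2 x) n).trans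
    (flowCosh_pow_le_flowMass hr hr1 h1 h2 hx)

lemma flowMass_le_exp (hr : 0 < r) (hr1 : r ≤ 1) (h1 : -1 < ν) (h2 : ν ≤ 1) {x : ℝ}
    (hx : 0 ≤ x) : flowMass n r ν x ≤ r⁻¹ * exp x ^ n := by
  refine le_of_hasDerivAt_le (a := 0) (G := fun x => r⁻¹ * exp x ^ n)
    (fun y _ => hasDerivAt_flowMass n r ν y)
    (fun y _ => ((Real.hasDerivAt_exp y).pow n).const_mul r⁻¹) (fun y hy => ?_) ?_ hx
  · rcases Nat.eq_zero_or_pos n with rfl | hn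
    · simp
    have : exp y ^ (n - 1) * exp y = exp y ^ n := by
      rw [← pow_succ, Nat.sub_add_cancel hn]
    rw [mul_assoc, this]
    have h := flowCosh_le_exp h2 hy
    have hp := (flowCosh_pos h1 h2 y).le
    have h3 := (one_le_inv₀ hr).2 hr1
    calc (n : ℝ) * flowCosh ν y ^ n ≤ n * exp y ^ n := by gcongr
      _ ≤ r⁻¹ * (n * exp y ^ n) := le_mul_of_one_le_left (by positivity) h3
  · rw [flowMass_zero]; simp

lemma flowCosh_le_max {x y : ℝ} (h1 : -1 < ν) (h2 : ν ≤ 1) (hy : 0 ≤ y) (hyx : y ≤ x) :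
    flowCosh ν y ≤ max 1 (flowCosh ν x) := by
  have hc : ConvexOn ℝ univ (flowCosh ν) := by
    have e1 : ConvexOn ℝ univ (fun x : ℝ => exp (-x)) := by
      have := convexOn_exp.comp_linearMap (-LinearMap.id : ℝ →ₗ[ℝ] ℝ)
      simpa [Function.comp_def] using this
    exact (convexOn_exp.smul (c := (1 + ν) / 2) (by linarith)).add
      (e1.smul (c := (1 - ν) / 2) (by linarith))
  have := hc.le_max_of_mem_Icc (mem_univ 0) (mem_univ x) ⟨hy, hyx⟩
  rwa [flowCosh_zero] at this

lemma one_le_mul_flowCosh {x : ℝ} (h1 : -1 < ν) (h2 : ν ≤ 1) (hx : 0 ≤ x) :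
    1 ≤ max 1 (3 / 2 * ((1 - ν) / (1 + ν))) * flowCosh ν x := by
  have hb : 1 ≤ exp x := Real.one_le_exp hx
  have hbi : exp x * exp (-x) = 1 := by rw [← Real.exp_add]; simp
  have hp := Real.exp_pos (-x)
  have hh := flowCosh_pos h1 h2 x
  rcases le_total 0 ν with h | h
  · have : 1 ≤ flowCosh ν x := by
      unfold flowCosh
      nlinarith [mul_nonneg (sub_nonneg.2 hb) (sub_nonneg.2 hb), mul_nonneg h (sub_nonneg.2 hb)]
    calc 1 ≤ flowCosh ν x := this
      _ ≤ _ := le_mul_of_one_le_left hh.le (le_max_left _ _)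
  · have h3 : 1 + ν ≤ flowCosh ν x := by
      unfold flowCosh
      nlinarith [mul_nonneg (sub_nonneg.2 hb) (sub_nonneg.2 hb), sq_nonneg (exp x - exp (-x))]
    have h4 : 3 / 2 * ((1 - ν) / (1 + ν)) * (1 + ν) = 3 / 2 * (1 - ν) := by
      field_simp [(by linarith : (1 + ν) ≠ 0)]
    have h5 : 0 ≤ 3 / 2 * ((1 - ν) / (1 + ν)) := by
      have : 0 ≤ (1 - ν) / (1 + ν) := div_nonneg (by linarith) (by linarith)
      linarith
    calc (1 : ℝ) ≤ 3 / 2 * ((1 - ν) / (1 + ν)) * (1 + ν) := by rw [h4]; linarith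
      _ ≤ 3 / 2 * ((1 - ν) / (1 + ν)) * flowCosh ν x := by gcongr
      _ ≤ _ := by gcongr; exact le_max_right _ _

lemma flowMass_le_of_le_one (h1 : -1 < ν) (h2 : ν ≤ 1) {x : ℝ} (hx : 0 ≤ x) (hx1 : x ≤ 1)
    (hr : 0 < r) (hr1 : r ≤ 1 / 5) (hn : 2 ≤ n) :
    flowMass n r ν x ≤
      2 * n * max 1 (3 / 2 * ((1 - ν) / (1 + ν))) ^ n / r * flowCosh ν x ^ n := by
  set M := max 1 (3 / 2 * ((1 - ν) / (1 + ν))) with hM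
  have hM1 : 1 ≤ M := le_max_left _ _
  have hh := flowCosh_pos h1 h2 x
  have hone := one_le_mul_flowCosh h1 h2 hx
  rw [← hM] at hone
  have hcurv : ∫ y in (0 : ℝ)..x, flowCosh ν y ^ n ≤ x * (M * flowCosh ν x) ^ n := by
    have hc : Continuous fun y => flowCosh ν y ^ n := (continuous_flowCosh ν).pow n
    calc ∫ y in (0 : ℝ)..x, flowCosh ν y ^ n
        ≤ ∫ _ in (0 : ℝ)..x, (M * flowCosh ν x) ^ n := by
          refine intervalIntegral.integral_mono_on hx (hc.intervalIntegrable _ _)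
            (continuous_const.intervalIntegrable _ _) fun y hy => ?_
          refine pow_le_pow_left₀ (flowCosh_pos h1 h2 y).le ?_ n
          exact (flowCosh_le_max h1 h2 hy.1 hy.2).trans
            (max_le hone (le_mul_of_one_le_left hh.le hM1))
      _ = x * (M * flowCosh ν x) ^ n := by simp
  have hpow : 1 ≤ (M * flowCosh ν x) ^ n := one_le_pow₀ hone
  have hrinv : 5 ≤ r⁻¹ := by
    rw [le_inv_comm₀ (by norm_num) hr]; linarith
  have hn' : (2 : ℝ) ≤ n := by exact_mod_cast hn
  have e : 2 * n * M ^ n / r * flowCosh ν x ^ n = 2 * n * r⁻¹ * (M * flowCosh ν x) ^ n := by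
    rw [mul_pow]; ring
  rw [e]
  unfold flowMass
  set P := (M * flowCosh ν x) ^ n
  calc r⁻¹ + n * ∫ y in (0 : ℝ)..x, flowCosh ν y ^ n ≤ r⁻¹ * P + n * (1 * P) := by
        gcongr
        · exact le_mul_of_one_le_right (by positivity) hpow
        · exact hcurv.trans (by gcongr)
    _ = (r⁻¹ + n) * P := by ring
    _ ≤ 2 * n * r⁻¹ * P := by
        gcongr
        nlinarith

lemma flowMass_le (h1 : -1 < ν) (h2 : ν ≤ 1) {x : ℝ} (hx : 0 ≤ x)
    (hr : 0 < r) (hr1 : r ≤ 1 / 5) (hn : 2 ≤ n) :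
    flowMass n r ν x ≤
      2 * n * max 1 (3 / 2 * ((1 - ν) / (1 + ν))) ^ n / r * flowCosh ν x ^ n := by
  rcases le_total x 1 with hx1 | hx1
  · exact flowMass_le_of_le_one h1 h2 hx hx1 hr hr1 hn
  have hn' : (2 : ℝ) ≤ n := by exact_mod_cast hn
  have hrinv : 5 ≤ r⁻¹ := by
    rw [le_inv_comm₀ (by norm_num) hr]; linarith
  set M := max 1 (3 / 2 * ((1 - ν) / (1 + ν))) with hM
  have hM1 : 1 ≤ M := le_max_left _ _
  have hν : 0 < 1 + ν := by linarith
  rcases le_total 2 ((1 - ν) / (1 + ν)) with hR | hR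
  · have hM2 : 1 ≤ M * ((1 + ν) / 2) := by
      have : 1 + (1 - ν) / (1 + ν) ≤ M := le_trans (by linarith) (le_max_right _ _)
      calc (1 : ℝ) = (1 + (1 - ν) / (1 + ν)) * ((1 + ν) / 2) := by field_simp; ring
        _ ≤ M * ((1 + ν) / 2) := by gcongr
    have hexp : exp x ≤ M * flowCosh ν x := by
      calc exp x ≤ M * ((1 + ν) / 2) * exp x := le_mul_of_one_le_left (Real.exp_pos x).le hM2
        _ = M * ((1 + ν) / 2 * exp x) := by ring
        _ ≤ M * flowCosh ν x := by
          gcongr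
          exact le_flowCosh h2 x
    calc flowMass n r ν x ≤ r⁻¹ * exp x ^ n := flowMass_le_exp hr (by linarith) h1 h2 hx
      _ ≤ r⁻¹ * (M * flowCosh ν x) ^ n := by
          gcongr
      _ = 1 * (r⁻¹ * (M * flowCosh ν x) ^ n) := by ring
      _ ≤ (2 * n) * (r⁻¹ * (M * flowCosh ν x) ^ n) := by
          have := flowCosh_pos h1 h2 x
          gcongr; linarith
      _ = _ := by rw [mul_pow]; ring
  · have hνlow : 1 - ν ≤ 2 * (1 + ν) := (div_le_iff₀ hν).1 hR
    set C := 2 * n * M ^ n / r with hC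
    have hC0 : 20 ≤ C := by
      have h3 : 1 ≤ M ^ n := one_le_pow₀ hM1
      have : C = 2 * n * r⁻¹ * M ^ n := by rw [hC]; ring
      rw [this]
      have : 20 ≤ 2 * n * r⁻¹ := by nlinarith
      nlinarith
    refine le_of_hasDerivAt_le (a := 1) (G := fun x => C * flowCosh ν x ^ n)
      (fun y _ => hasDerivAt_flowMass n r ν y)
      (fun y _ => ((hasDerivAt_flowCosh ν y).pow n).const_mul C) (fun y hy => ?_)
      (flowMass_le_of_le_one h1 h2 zero_le_one le_rfl hr hr1 hn) hx1
    have hs : flowCosh ν y ≤ 20 * flowSinh ν y := by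
      have e1 : (2 : ℝ) ≤ exp y := by linarith [Real.add_one_le_exp y]
      have hbi : exp y * exp (-y) = 1 := by rw [← Real.exp_add]; simp
      have hp := Real.exp_pos (-y)
      have e2 : 4 * exp (-y) ≤ exp y := by nlinarith
      have : (1 - ν) * exp (-y) ≤ 2 * (1 + ν) * exp (-y) := by gcongr
      have : (1 + ν) * (4 * exp (-y)) ≤ (1 + ν) * exp y := by gcongr
      unfold flowCosh flowSinh
      nlinarith
    have hh := flowCosh_pos h1 h2 y
    have hs0 : 0 < flowSinh ν y := by linarith
    have hk : flowCosh ν y ^ n = flowCosh ν y ^ (n - 1) * flowCosh ν y := by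
      rw [← pow_succ, Nat.sub_add_cancel (by omega)]
    calc (n : ℝ) * flowCosh ν y ^ n = n * flowCosh ν y ^ (n - 1) * flowCosh ν y := by
          rw [hk]; ring
      _ ≤ n * flowCosh ν y ^ (n - 1) * (20 * flowSinh ν y) := by gcongr
      _ = 20 * (n * flowCosh ν y ^ (n - 1) * flowSinh ν y) := by ring
      _ ≤ C * (n * flowCosh ν y ^ (n - 1) * flowSinh ν y) := by gcongr

lemma flowScale_pos (h1 : -1 < ν) (h2 : ν ≤ 1) (x : ℝ) : 0 < flowScale n r ν x :=
  mul_pos (flowCosh_pos h1 h2 x) (Real.exp_pos _)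

lemma flowScale_pow (hn : n ≠ 0) (hr : 0 < r) (h1 : -1 < ν) (h2 : ν ≤ 1) {x : ℝ} (hx : 0 ≤ x) :
    flowScale n r ν x ^ n = flowCosh ν x ^ n / flowMass n r ν x := by
  have hn' : (n : ℝ) ≠ 0 := by exact_mod_cast hn
  have : exp (-(log (flowMass n r ν x) / n)) ^ n = (flowMass n r ν x)⁻¹ := by
    rw [← Real.exp_nat_mul, ← mul_neg_one, ← mul_assoc, mul_div_cancel₀ _ hn', mul_neg_one,
      Real.exp_neg, Real.exp_log (flowMass_pos hr h1 h2 hx)]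
  rw [flowScale, mul_pow, this, div_eq_mul_inv]

lemma flowScale_le_one (hn : n ≠ 0) (hr : 0 < r) (hr1 : r ≤ 1) (h1 : -1 < ν) (h2 : ν ≤ 1)
    {x : ℝ} (hx : 0 ≤ x) : flowScale n r ν x ≤ 1 := by
  rw [← pow_le_one_iff_of_nonneg (flowScale_pos h1 h2 x).le hn, flowScale_pow hn hr h1 h2 hx]
  exact div_le_one_of_le₀ (flowCosh_pow_le_flowMass hr hr1 h1 h2 hx)
    (flowMass_pos hr h1 h2 hx).le

lemma hasDerivAt_flowScale (hn : n ≠ 0) (hr : 0 < r) (h1 : -1 < ν) (h2 : ν ≤ 1)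
    {x : ℝ} (hx : 0 ≤ x) :
    HasDerivAt (flowScale n r ν)
      (flowScale n r ν x * (flowSinh ν x / flowCosh ν x - flowScale n r ν x ^ n)) x := by
  have hQ := flowMass_pos (n := n) hr h1 h2 hx
  have hn' : (n : ℝ) ≠ 0 := by exact_mod_cast hn
  have hh := (flowCosh_pos h1 h2 x).ne'
  refine ((hasDerivAt_flowCosh ν x).mul
    ((((hasDerivAt_flowMass n r ν x).log hQ.ne').div_const (n : ℝ)).fun_neg.exp)).congr_deriv ?_
  rw [flowScale_pow hn hr h1 h2 hx]
  simp only [flowScale]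
  field_simp
  ring

lemma hasDerivAt_flowCos (h1 : -1 < ν) (h2 : ν ≤ 1) (x : ℝ) :
    HasDerivAt (fun x => flowSinh ν x / flowCosh ν x)
      (1 - (flowSinh ν x / flowCosh ν x) ^ 2) x := by
  have hh := (flowCosh_pos h1 h2 x).ne'
  refine ((hasDerivAt_flowSinh ν x).div (hasDerivAt_flowCosh ν x) hh).congr_deriv ?_
  field_simp

lemma abs_flowCos_le (h1 : -1 < ν) (h2 : ν ≤ 1) (x : ℝ) :
    (flowSinh ν x / flowCosh ν x) ^ 2 ≤ 1 := by
  have hh := flowCosh_pos h1 h2 x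
  rw [div_pow, div_le_one (by positivity)]
  nlinarith [flowCosh_sq_sub ν x]

/-- Squared distance to the target as a function of the rescaled time. -/
def flowErr (n : ℕ) (r ν x : ℝ) : ℝ :=
  sqDist (flowScale n r ν x ^ n) (flowSinh ν x / flowCosh ν x)

lemma flowErr_nonneg (h1 : -1 < ν) (h2 : ν ≤ 1) (x : ℝ) : 0 ≤ flowErr n r ν x := by
  unfold flowErr sqDist
  nlinarith [abs_flowCos_le h1 h2 x,
    sq_nonneg (flowScale n r ν x ^ n - flowSinh ν x / flowCosh ν x)]

lemma hasDerivAt_flowErr (hn : n ≠ 0) (hr : 0 < r) (h1 : -1 < ν) (h2 : ν ≤ 1)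
    {x : ℝ} (hx : 0 ≤ x) :
    HasDerivAt (flowErr n r ν)
      (-2 * n * flowScale n r ν x ^ n *
          (flowScale n r ν x ^ n - flowSinh ν x / flowCosh ν x) ^ 2
        - 2 * flowScale n r ν x ^ n * (1 - (flowSinh ν x / flowCosh ν x) ^ 2)) x := by
  have e1 := (hasDerivAt_flowScale hn hr h1 h2 hx).pow n
  have e2 := hasDerivAt_flowCos h1 h2 x
  refine (((e1.pow 2).sub ((e1.const_mul 2).mul e2)).add_const 1).congr_deriv ?_
  have : flowScale n r ν x ^ n = flowScale n r ν x ^ (n - 1) * flowScale n r ν x := by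
    rw [← pow_succ, Nat.sub_add_cancel (by omega)]
  set c := flowSinh ν x / flowCosh ν x
  simp only [Pi.pow_apply]
  push_cast
  have h' : ∀ z : ℝ, (n : ℝ) * flowScale n r ν x ^ (n - 1) * (flowScale n r ν x * z)
      = n * flowScale n r ν x ^ n * z := by intro z; rw [this]; ring
  rw [h']
  ring

lemma continuousOn_flowErr (hn : n ≠ 0) (hr : 0 < r) (h1 : -1 < ν) (h2 : ν ≤ 1) :
    ContinuousOn (flowErr n r ν) (Ici 0) := fun _ hx =>
  (hasDerivAt_flowErr hn hr h1 h2 hx).continuousAt.continuousWithinAt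

lemma flowErr_pow_mul_le (hn : n ≠ 0) (hr : 0 < r) (hr1 : r ≤ 1 / 5) (h1 : -1 < ν) (h2 : ν ≤ 1)
    {x : ℝ} (hx : 0 ≤ x) :
    flowErr n r ν x ^ n * flowMass n r ν x ^ 2 ≤ (36 / 25) ^ n * r⁻¹ ^ 2 := by
  have h0 : flowErr n r ν 0 ^ n * flowMass n r ν 0 ^ 2 ≤ (36 / 25) ^ n * r⁻¹ ^ 2 := by
    have h3 : flowErr n r ν 0 ≤ 36 / 25 := by
      unfold flowErr
      rw [flowScale_pow hn hr h1 h2 le_rfl, flowMass_zero, flowCosh_zero, flowSinh_zero, one_pow,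
        one_div, inv_inv, div_one, sqDist]
      nlinarith
    have := flowErr_nonneg (n := n) (r := r) h1 h2 0
    rw [flowMass_zero]
    gcongr
  refine (le_of_hasDerivAt_le (a := 0) (F := fun x => flowErr n r ν x ^ n * flowMass n r ν x ^ 2)
    (G := fun _ => flowErr n r ν 0 ^ n * flowMass n r ν 0 ^ 2)
    (fun y hy => ((hasDerivAt_flowErr hn hr h1 h2 hy).pow n).mul
      ((hasDerivAt_flowMass n r ν y).pow 2))
    (fun y _ => hasDerivAt_const y _) (fun y hy => ?_) le_rfl hx).trans h0
  have hQ := flowMass_pos (n := n) hr h1 h2 hy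
  have hρ : (0 : ℝ) < flowScale n r ν y ^ n := pow_pos (flowScale_pos h1 h2 y) n
  have hE := flowErr_nonneg (n := n) (r := r) h1 h2 y
  have hcos := abs_flowCos_le h1 h2 y
  have hn1 : (1 : ℝ) ≤ n := by exact_mod_cast Nat.one_le_iff_ne_zero.2 hn
  have hQe : flowCosh ν y ^ n = flowScale n r ν y ^ n * flowMass n r ν y := by
    rw [flowScale_pow hn hr h1 h2 hy]; field_simp
  have hEdef : flowErr n r ν y = (flowScale n r ν y ^ n - flowSinh ν y / flowCosh ν y) ^ 2
      + (1 - (flowSinh ν y / flowCosh ν y) ^ 2) := by unfold flowErr sqDist; ring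
  have hk : flowErr n r ν y ^ n = flowErr n r ν y ^ (n - 1) * flowErr n r ν y := by
    rw [← pow_succ, Nat.sub_add_cancel (by omega)]
  simp only [Pi.pow_apply]
  rw [hQe, hk]
  set c := flowSinh ν y / flowCosh ν y
  set ρ := flowScale n r ν y ^ n
  set Q := flowMass n r ν y
  set p := flowErr n r ν y ^ (n - 1) with hp
  have hp0 : 0 ≤ p := pow_nonneg hE _
  rw [hEdef]
  have : n * p * (-2 * n * ρ * (ρ - c) ^ 2 - 2 * ρ * (1 - c ^ 2)) * Q ^ 2 +
      p * ((ρ - c) ^ 2 + (1 - c ^ 2)) * ((2 : ℕ) * Q ^ (2 - 1) * (n * (ρ * Q))) =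
      - (2 * n * p * ρ * Q ^ 2 * ((n - 1) * (ρ - c) ^ 2)) := by
    push_cast; ring
  rw [this]
  have : 0 ≤ 2 * n * p * ρ * Q ^ 2 * ((n - 1) * (ρ - c) ^ 2) :=
    mul_nonneg (by positivity) (mul_nonneg (by linarith) (sq_nonneg _))
  linarith

lemma flowErr_le (hn : n ≠ 0) (hr : 0 < r) (hr1 : r ≤ 1 / 5) (h1 : -1 < ν) (h2 : ν ≤ 1)
    {x : ℝ} (hx : 0 ≤ x) : flowErr n r ν x ≤ 36 / 25 := by
  have h := flowErr_pow_mul_le hn hr hr1 h1 h2 hx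
  have hE := flowErr_nonneg (n := n) (r := r) h1 h2 x
  have hri := inv_pos.2 hr
  have hQ := inv_le_flowMass (n := n) (r := r) h1 h2 hx
  have h3 : flowErr n r ν x ^ n * r⁻¹ ^ 2 ≤ (36 / 25) ^ n * r⁻¹ ^ 2 :=
    le_trans (by gcongr) h
  have h4 := le_of_mul_le_mul_right h3 (by positivity)
  exact (pow_le_pow_iff_left₀ hE (by norm_num) hn).1 h4

lemma flowErr_le_exp (hn : n ≠ 0) (hr : 0 < r) (hr1 : r ≤ 1 / 5) (h1 : -1 < ν) (h2 : ν ≤ 1)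
    {x : ℝ} (hx : 0 ≤ x) :
    flowErr n r ν x ≤ (6 / 5 * (2 / (1 + ν) / flowScale n r ν 0 * exp (-x))) ^ 2 := by
  have h := flowErr_pow_mul_le hn hr hr1 h1 h2 hx
  have hE := flowErr_nonneg (n := n) (r := r) h1 h2 x
  have hri := inv_pos.2 hr
  have hQ := exp_le_flowMass (n := n) hr (by linarith) h1 h2 hx
  have hν : 0 < 1 + ν := by linarith
  have hσ := flowScale_pos (n := n) (r := r) h1 h2 0
  have hσn : flowScale n r ν 0 ^ n = r := by
    rw [flowScale_pow hn hr h1 h2 le_rfl, flowMass_zero, flowCosh_zero]; simp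
  rw [← pow_le_pow_iff_left₀ hE (by positivity) hn]
  have h3 : flowErr n r ν x ^ n * (((1 + ν) / 2 * exp x) ^ n) ^ 2 ≤ (36 / 25) ^ n * r⁻¹ ^ 2 :=
    le_trans (by gcongr) h
  have e : (((6 : ℝ) / 5 * (2 / (1 + ν) / flowScale n r ν 0 * exp (-x))) ^ 2) ^ n
      = ((36 / 25) ^ n * r⁻¹ ^ 2) / (((1 + ν) / 2 * exp x) ^ n) ^ 2 := by
    generalize flowScale n r ν 0 = s at hσ hσn ⊢
    rw [← hσn, Real.exp_neg, ← inv_pow, ← pow_mul, ← pow_mul, ← pow_mul, mul_comm n 2, pow_mul,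
      pow_mul, pow_mul, ← mul_pow, ← div_pow]
    congr 1
    field_simp
    norm_num
  rw [e, le_div_iff₀ (by positivity)]
  exact h3

/-- The physical time as a function of the rescaled time. -/
def flowTime (n : ℕ) (r ν x : ℝ) : ℝ :=
  ∫ y in (0 : ℝ)..x, (flowScale n r ν (max y 0) ^ (n - 2))⁻¹

lemma continuous_flowTime_integrand (hn : n ≠ 0) (hr : 0 < r) (h1 : -1 < ν) (h2 : ν ≤ 1) :
    Continuous fun y => (flowScale n r ν (max y 0) ^ (n - 2))⁻¹ := by
  have h : ContinuousOn (flowScale n r ν) (Ici 0) := fun x hx =>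
    (hasDerivAt_flowScale hn hr h1 h2 hx).continuousAt.continuousWithinAt
  have h' : Continuous fun y : ℝ => flowScale n r ν (max y 0) :=
    h.comp_continuous (by fun_prop) fun y => mem_Ici.2 (le_max_right _ _)
  exact (h'.pow _).inv₀ fun y => (pow_pos (flowScale_pos h1 h2 _) _).ne'

lemma hasDerivAt_flowTime (hn : n ≠ 0) (hr : 0 < r) (h1 : -1 < ν) (h2 : ν ≤ 1) (x : ℝ) :
    HasDerivAt (flowTime n r ν) (flowScale n r ν (max x 0) ^ (n - 2))⁻¹ x :=
  ((continuous_flowTime_integrand hn hr h1 h2).integral_hasStrictDerivAt 0 x).hasDerivAt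

lemma flowTime_zero : flowTime n r ν 0 = 0 := by simp [flowTime]

lemma one_le_flowTime_integrand (hn : n ≠ 0) (hr : 0 < r) (hr1 : r ≤ 1) (h1 : -1 < ν)
    (h2 : ν ≤ 1) (x : ℝ) : 1 ≤ (flowScale n r ν (max x 0) ^ (n - 2))⁻¹ :=
  (one_le_inv₀ (pow_pos (flowScale_pos h1 h2 _) _)).2
    (pow_le_one₀ (flowScale_pos h1 h2 _).le (flowScale_le_one hn hr hr1 h1 h2 (le_max_right _ _)))

lemma flowTime_strictMono (hn : n ≠ 0) (hr : 0 < r) (h1 : -1 < ν) (h2 : ν ≤ 1) :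
    StrictMono (flowTime n r ν) := by
  apply strictMono_of_deriv_pos
  intro x
  rw [(hasDerivAt_flowTime hn hr h1 h2 x).deriv]
  exact inv_pos.2 (pow_pos (flowScale_pos h1 h2 _) _)

lemma flowTime_surjective (hn : n ≠ 0) (hr : 0 < r) (hr1 : r ≤ 1) (h1 : -1 < ν) (h2 : ν ≤ 1) :
    Function.Surjective (flowTime n r ν) := by
  have hmono : Monotone fun x => flowTime n r ν x - x := by
    apply monotone_of_deriv_nonneg
    · exact fun x => ((hasDerivAt_flowTime hn hr h1 h2 x).sub (hasDerivAt_id x)).differentiableAt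
    · intro x
      have := ((hasDerivAt_flowTime hn hr h1 h2 x).fun_sub (hasDerivAt_id x)).deriv
      simp only [id] at this
      rw [this]
      linarith [one_le_flowTime_integrand hn hr hr1 h1 h2 x]
  have hc : Continuous (flowTime n r ν) :=
    continuous_iff_continuousAt.2 fun x => (hasDerivAt_flowTime hn hr h1 h2 x).continuousAt
  refine hc.surjective ?_ ?_
  · refine Filter.tendsto_atTop_mono' _ ?_ Filter.tendsto_id
    filter_upwards [Filter.eventually_ge_atTop 0] with x hx
    have := hmono hx
    simp only [flowTime_zero] at this
    simp only [id]; linarith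
  · refine Filter.tendsto_atBot_mono' _ ?_ Filter.tendsto_id
    filter_upwards [Filter.eventually_le_atBot 0] with x hx
    have := hmono hx
    simp only [flowTime_zero] at this
    simp only [id]; linarith

/-- The rescaled time as a function of the physical time. -/
lemma exists_flowTime_inverse (hn : n ≠ 0) (hr : 0 < r) (hr1 : r ≤ 1) (h1 : -1 < ν)
    (h2 : ν ≤ 1) :
    ∃ τ : ℝ → ℝ, τ 0 = 0 ∧ (∀ t, flowTime n r ν (τ t) = t) ∧ Monotone τ ∧
      ∀ t ≥ 0, HasDerivAt τ (flowScale n r ν (τ t) ^ (n - 2)) t := by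
  have hm := flowTime_strictMono (n := n) hn hr h1 h2
  let e := hm.orderIsoOfSurjective _ (flowTime_surjective hn hr hr1 h1 h2)
  have he : ∀ x, e x = flowTime n r ν x := fun x => rfl
  have hright : ∀ t, flowTime n r ν (e.symm t) = t := fun t => by
    rw [← he, OrderIso.apply_symm_apply]
  have h0 : e.symm 0 = 0 := by
    rw [OrderIso.symm_apply_eq, he, flowTime_zero]
  refine ⟨e.symm, h0, hright, e.symm.monotone, fun t ht => ?_⟩
  have hτ : 0 ≤ e.symm t := by
    rw [← h0]; exact e.symm.monotone ht
  have hd := hasDerivAt_flowTime (n := n) hn hr h1 h2 (e.symm t)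
  rw [max_eq_left hτ] at hd
  have := HasDerivAt.of_local_left_inverse (e.symm.continuous.continuousAt) hd
    (inv_pos.2 (pow_pos (flowScale_pos h1 h2 _) _)).ne' (Filter.Eventually.of_forall hright)
  rwa [inv_inv] at this

lemma flowTime_le (hn : 2 ≤ n) (hr : 0 < r) (hr1 : r ≤ 1 / 5) (h1 : -1 < ν) (h2 : ν ≤ 1)
    {x : ℝ} (hx : 0 ≤ x) :
    flowTime n r ν x ≤ 2 * n * max 1 (3 / 2 * ((1 - ν) / (1 + ν))) ^ n / r * x := by
  have hn0 : n ≠ 0 := by omega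
  set C := 2 * n * max 1 (3 / 2 * ((1 - ν) / (1 + ν))) ^ n / r with hC
  calc flowTime n r ν x ≤ ∫ _ in (0 : ℝ)..x, C := by
        refine intervalIntegral.integral_mono_on hx
          ((continuous_flowTime_integrand hn0 hr h1 h2).intervalIntegrable _ _)
          (continuous_const.intervalIntegrable _ _) fun y hy => ?_
        rw [max_eq_left hy.1]
        have hσ := flowScale_pos (n := n) (r := r) h1 h2 y
        have hQ := flowMass_pos (n := n) hr h1 h2 hy.1
        have hh := pow_pos (flowCosh_pos h1 h2 y) n
        have : flowScale n r ν y ^ n ≤ flowScale n r ν y ^ (n - 2) :=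
          pow_le_pow_of_le_one hσ.le (flowScale_le_one hn0 hr (by linarith) h1 h2 hy.1) (by omega)
        calc (flowScale n r ν y ^ (n - 2))⁻¹ ≤ (flowScale n r ν y ^ n)⁻¹ :=
              inv_anti₀ (pow_pos hσ n) this
          _ = flowMass n r ν y / flowCosh ν y ^ n := by
              rw [flowScale_pow hn0 hr h1 h2 hy.1, inv_div]
          _ ≤ C := by
              rw [div_le_iff₀ hh]
              exact flowMass_le h1 h2 hy.1 hr hr1 hn
    _ = C * x := by simp [mul_comm]

lemma flowScale_zero_pow (hn : n ≠ 0) (hr : 0 < r) (h1 : -1 < ν) (h2 : ν ≤ 1) :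
    flowScale n r ν 0 ^ n = r := by
  rw [flowScale_pow hn hr h1 h2 le_rfl, flowMass_zero, flowCosh_zero]; simp

lemma two_div_one_add_le (h1 : -1 < ν) : 2 / (1 + ν) ≤ 2 * max 1 ((1 - ν) / (1 + ν)) := by
  have hν : 0 < 1 + ν := by linarith
  have e : 2 / (1 + ν) = 1 + (1 - ν) / (1 + ν) := by field_simp; ring
  rw [e]
  linarith [le_max_left 1 ((1 - ν) / (1 + ν)), le_max_right 1 ((1 - ν) / (1 + ν))]

lemma flowErr_le_of_log_le (hn : 2 ≤ n) (hr : 0 < r) (hr1 : r ≤ 1 / 5) (h1 : -1 < ν)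
    (h2 : ν ≤ 1) {ε : ℝ} (hε : 0 < ε) {x : ℝ}
    (hx : log (15 * n * max 1 ((1 - ν) / (1 + ν)) / (r * min 1 (2 * ε))) ≤ x) :
    flowErr n r ν x ≤ 2 * ε := by
  have hn0 : n ≠ 0 := by omega
  have hn' : (2 : ℝ) ≤ n := by exact_mod_cast hn
  have hM : 1 ≤ max 1 ((1 - ν) / (1 + ν)) := le_max_left _ _
  have h2M := two_div_one_add_le h1
  set M := max 1 ((1 - ν) / (1 + ν))
  have hδ : 0 < min 1 (2 * ε) := lt_min one_pos (by linarith)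
  have hδ1 : min 1 (2 * ε) ≤ 1 := min_le_left _ _
  have hδ2 : min 1 (2 * ε) ≤ 2 * ε := min_le_right _ _
  set δ := min 1 (2 * ε)
  have harg : 1 ≤ 15 * n * M / (r * δ) := by
    rw [one_le_div (by positivity)]
    nlinarith [mul_le_mul hr1 hδ1 hδ.le (by norm_num)]
  have hx0 : 0 ≤ x := (log_nonneg harg).trans hx
  have hexp : exp (-x) ≤ r * δ / (15 * n * M) := by
    rw [Real.exp_neg, ← inv_div]
    refine inv_anti₀ (by positivity) ?_
    rw [← Real.log_le_iff_le_exp (by positivity)]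
    exact hx
  have hσ := flowScale_pos (n := n) (r := r) h1 h2 0
  have hσr : r ≤ flowScale n r ν 0 := by
    have := flowScale_le_one (n := n) hn0 hr (by linarith) h1 h2 le_rfl
    calc r = flowScale n r ν 0 ^ n := (flowScale_zero_pow hn0 hr h1 h2).symm
      _ ≤ flowScale n r ν 0 := pow_le_of_le_one hσ.le this hn0
  have hν : 0 < 1 + ν := by linarith
  have key : 6 / 5 * (2 / (1 + ν) / flowScale n r ν 0 * exp (-x)) ≤ δ := by
    calc 6 / 5 * (2 / (1 + ν) / flowScale n r ν 0 * exp (-x))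
        ≤ 6 / 5 * (2 * M / r * (r * δ / (15 * n * M))) := by gcongr
      _ = 12 / (75 * n) * δ := by field_simp; ring
      _ ≤ 1 * δ := by
          gcongr
          rw [div_le_one (by positivity)]; linarith
      _ = δ := one_mul _
  calc flowErr n r ν x ≤ (6 / 5 * (2 / (1 + ν) / flowScale n r ν 0 * exp (-x))) ^ 2 :=
        flowErr_le_exp hn0 hr hr1 h1 h2 hx0
    _ ≤ δ ^ 2 := by gcongr
    _ ≤ 2 * ε := by nlinarith

lemma integral_le_log_add_one {g : ℝ → ℝ} {A x : ℝ} (hA : 1 ≤ A) (hx : 0 ≤ x)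
    (hg : ContinuousOn g (Ici 0)) (h1 : ∀ y ≥ 0, g y ≤ 1) (h2 : ∀ y ≥ 0, g y ≤ A * exp (-y)) :
    ∫ y in (0 : ℝ)..x, g y ≤ log A + 1 := by
  have hcurv : ∀ a b, 0 ≤ a → a ≤ b → IntervalIntegrable g MeasureTheory.volume a b :=
    fun a b ha hab => (hg.mono fun y hy => by
      rw [uIcc_of_le hab] at hy; exact ha.trans hy.1).intervalIntegrable
  have hb : ∀ b, 0 ≤ b → ∫ y in (0 : ℝ)..b, g y ≤ b := fun b hb => by
    calc ∫ y in (0 : ℝ)..b, g y ≤ ∫ _ in (0 : ℝ)..b, (1 : ℝ) :=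
          intervalIntegral.integral_mono_on hb (hcurv 0 b le_rfl hb)
            (continuous_const.intervalIntegrable _ _) fun y hy => h1 y hy.1
      _ = b := by simp
  have hL : 0 ≤ log A := log_nonneg hA
  rcases le_total x (log A) with h | h
  · linarith [hb x hx]
  · rw [← intervalIntegral.integral_add_adjacent_intervals (hcurv 0 _ le_rfl hL) (hcurv _ x hL h)]
    have : ∫ y in (log A)..x, g y ≤ 1 := by
      have hd : ∀ y ∈ uIcc (log A) x, HasDerivAt (fun y => -(A * exp (-y))) (A * exp (-y)) y := by
        intro y _
        refine (((hasDerivAt_neg y).exp).const_mul A).neg.congr_deriv ?_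
        ring
      calc ∫ y in (log A)..x, g y ≤ ∫ y in (log A)..x, A * exp (-y) :=
            intervalIntegral.integral_mono_on h (hcurv _ x hL h)
              (Continuous.intervalIntegrable (by fun_prop) _ _) fun y hy => h2 y (hL.trans hy.1)
        _ = 1 - A * exp (-x) := by
            rw [intervalIntegral.integral_eq_sub_of_hasDerivAt hd
              (Continuous.intervalIntegrable (by fun_prop) _ _), Real.exp_neg (log A),
              Real.exp_log (by linarith), mul_inv_cancel₀ (by linarith)]
            ring
        _ ≤ 1 := by
            have := Real.exp_pos (-x)
            have : 0 ≤ A * exp (-x) := by positivity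
            linarith
    linarith [hb _ hL]

lemma integral_sqrt_flowErr_le (hn : 2 ≤ n) (hr : 0 < r) (hr1 : r ≤ 1 / 5) (h1 : -1 < ν)
    (h2 : ν ≤ 1) {x : ℝ} (hx : 0 ≤ x) :
    (n - 1) * ∫ y in (0 : ℝ)..x, √(flowErr n r ν y) ≤
      log ((n : ℝ) ^ 2 * (exp 2 * max 1 ((1 - ν) / (1 + ν))) ^ (5 * ((n : ℝ) - 1) / 2) / r ^ 2)
        := by
  have hn0 : n ≠ 0 := by omega
  have hn' : (2 : ℝ) ≤ n := by exact_mod_cast hn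
  have hM : 1 ≤ max 1 ((1 - ν) / (1 + ν)) := le_max_left _ _
  have h2M := two_div_one_add_le h1
  set M := max 1 ((1 - ν) / (1 + ν))
  have hν : 0 < 1 + ν := by linarith
  have hσ := flowScale_pos (n := n) (r := r) h1 h2 0
  have hσ1 := flowScale_le_one (n := n) hn0 hr (by linarith) h1 h2 le_rfl
  have hσn := flowScale_zero_pow (n := n) hn0 hr h1 h2
  set A := 2 / (1 + ν) / flowScale n r ν 0 with hA
  have hA1 : 1 ≤ A := by
    have : 1 ≤ 2 / (1 + ν) := by rw [one_le_div hν]; linarith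
    rw [hA, one_le_div hσ]; linarith
  have hI : ∫ y in (0 : ℝ)..x, 5 / 6 * √(flowErr n r ν y) ≤ log A + 1 := by
    refine integral_le_log_add_one hA1 hx ?_ (fun y hy => ?_) fun y hy => ?_
    · exact continuousOn_const.mul (continuousOn_flowErr hn0 hr h1 h2).sqrt
    · have : √(flowErr n r ν y) ≤ 6 / 5 := by
        rw [Real.sqrt_le_left (by norm_num)]
        exact (flowErr_le hn0 hr hr1 h1 h2 hy).trans (by norm_num)
      linarith
    · have : √(flowErr n r ν y) ≤ 6 / 5 * (A * exp (-y)) := by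
        rw [Real.sqrt_le_left (by positivity)]
        exact flowErr_le_exp hn0 hr hr1 h1 h2 hy
      linarith
  rw [intervalIntegral.integral_const_mul] at hI
  have hlogσ : log (flowScale n r ν 0) = log r / n := by
    have : n * log (flowScale n r ν 0) = log r := by rw [← Real.log_pow, hσn]
    rw [← this]; field_simp
  have hlogA : log A ≤ log 2 + log M - log r / n := by
    rw [hA, Real.log_div (by positivity) hσ.ne', hlogσ, ← Real.log_mul (by norm_num) (by positivity)]
    gcongr
  have hrhs : log ((n : ℝ) ^ 2 * (exp 2 * M) ^ (5 * ((n : ℝ) - 1) / 2) / r ^ 2) =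
      2 * log n + 5 * ((n : ℝ) - 1) / 2 * (2 + log M) - 2 * log r := by
    rw [Real.log_div (by positivity) (by positivity), Real.log_mul (by positivity) (by positivity),
      Real.log_rpow (by positivity), Real.log_mul (by positivity) (by positivity), Real.log_exp,
      Real.log_pow, Real.log_pow]
    push_cast; ring
  rw [hrhs]
  have hl2 : log 2 ≤ 1 := by linarith [Real.log_two_lt_d9]
  have hlM : 0 ≤ log M := log_nonneg hM
  have hln : 0 ≤ log n := log_nonneg (by linarith)
  have hlr : 0 ≤ -log r := by linarith [Real.log_nonpos hr.le (by linarith)]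
  have hlrn : (n - 1) * (-log r / n) ≤ -log r := by
    have : ((n : ℝ) - 1) * (-log r / n) = ((n - 1) / n) * (-log r) := by ring
    rw [this]
    refine mul_le_of_le_one_left hlr ?_
    rw [div_le_one (by positivity)]; linarith
  have hI' : ∫ y in (0 : ℝ)..x, √(flowErr n r ν y) ≤ 6 / 5 * (2 + log M + -log r / n) := by
    have : -log r / n = -(log r / n) := by ring
    linarith
  calc (n - 1) * ∫ y in (0 : ℝ)..x, √(flowErr n r ν y)
      ≤ (n - 1) * (6 / 5 * (2 + log M + -log r / n)) := by
        apply mul_le_mul_of_nonneg_left hI'; linarith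
    _ = 6 / 5 * ((n - 1) * (2 + log M)) + 6 / 5 * ((n - 1) * (-log r / n)) := by ring
    _ ≤ _ := by
        have : 0 ≤ ((n : ℝ) - 1) * (2 + log M) := mul_nonneg (by linarith) (by linarith)
        linarith

/-- The radial part of the balanced gradient flow, with explicit rate bounds. -/
theorem exists_radial_flow (hn : 2 ≤ n) (hr : 0 < r) (hr1 : r ≤ 1 / 5) (h1 : -1 < ν)
    (h2 : ν ≤ 1) :
    ∃ τ σ : ℝ → ℝ, τ 0 = 0 ∧ σ 0 ^ n = r ∧
      (∀ t ≥ 0, 0 < σ t ∧ σ t ≤ 1 ∧ HasDerivAt τ (σ t ^ (n - 2)) t ∧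
        HasDerivAt σ (σ t ^ (n - 1) *
          (flowSinh ν (τ t) / flowCosh ν (τ t) - σ t ^ n)) t) ∧
      (∀ ε > 0, 0 ≤ 2 * n * max 1 (3 / 2 * ((1 - ν) / (1 + ν))) ^ n / r *
          log (15 * n * max 1 ((1 - ν) / (1 + ν)) / (r * min 1 (2 * ε))) ∧
        ∀ t, t = 2 * n * max 1 (3 / 2 * ((1 - ν) / (1 + ν))) ^ n / r *
          log (15 * n * max 1 ((1 - ν) / (1 + ν)) / (r * min 1 (2 * ε))) →
        sqDist (σ t ^ n) (flowSinh ν (τ t) / flowCosh ν (τ t)) ≤ 2 * ε) ∧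
      ∀ t ≥ 0, (n - 1) * ∫ s in (0 : ℝ)..t,
          √(sqDist (σ s ^ n) (flowSinh ν (τ s) / flowCosh ν (τ s))) * σ s ^ (n - 2) ≤
        log ((n : ℝ) ^ 2 * (exp 2 * max 1 ((1 - ν) / (1 + ν))) ^ (5 * ((n : ℝ) - 1) / 2) /
          r ^ 2) := by
  have hn0 : n ≠ 0 := by omega
  have hn' : (2 : ℝ) ≤ n := by exact_mod_cast hn
  obtain ⟨τ, hτ0, hτ, hmono, hd⟩ := exists_flowTime_inverse (n := n) hn0 hr (by linarith) h1 h2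
  have hτnn : ∀ t ≥ 0, 0 ≤ τ t := fun t ht => by rw [← hτ0]; exact hmono ht
  refine ⟨τ, fun t => flowScale n r ν (τ t), hτ0, ?_, fun t ht => ⟨flowScale_pos h1 h2 _,
    flowScale_le_one hn0 hr (by linarith) h1 h2 (hτnn t ht), hd t ht, ?_⟩, fun ε hε => ?_,
    fun t ht => ?_⟩
  · simp only [hτ0]; exact flowScale_zero_pow hn0 hr h1 h2
  · refine ((hasDerivAt_flowScale hn0 hr h1 h2 (hτnn t ht)).comp t (hd t ht)).congr_deriv ?_
    obtain ⟨k, rfl⟩ : ∃ k, n = k + 2 := ⟨n - 2, by omega⟩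
    simp only [Nat.add_sub_cancel, show k + 2 - 1 = k + 1 by omega]
    ring
  · have hM : 1 ≤ max 1 ((1 - ν) / (1 + ν)) := le_max_left _ _
    have hlog : 0 ≤ log (15 * n * max 1 ((1 - ν) / (1 + ν)) / (r * min 1 (2 * ε))) := by
      refine log_nonneg ?_
      have hδ : 0 < min 1 (2 * ε) := lt_min one_pos (by linarith)
      rw [one_le_div (by positivity)]
      have := mul_le_mul hr1 (min_le_left 1 (2 * ε)) hδ.le (by norm_num)
      nlinarith
    refine ⟨by positivity, fun t ht => flowErr_le_of_log_le hn hr hr1 h1 h2 hε ?_⟩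
    rw [← (flowTime_strictMono (n := n) hn0 hr h1 h2).le_iff_le, hτ, ht]
    exact flowTime_le hn hr hr1 h1 h2 hlog
  · have : ∫ s in (0 : ℝ)..t, ((fun x => √(flowErr n r ν x)) ∘ τ) s *
          flowScale n r ν (τ s) ^ (n - 2) =
        ∫ x in τ 0..τ t, √(flowErr n r ν x) := by
      have hsub : ∀ s ∈ uIcc 0 t, (0 : ℝ) ≤ s := fun s hs => by
        rw [uIcc_of_le ht] at hs; exact hs.1
      refine intervalIntegral.integral_comp_mul_deriv' (fun s hs => hd s (hsub s hs)) ?_ ?_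
      · intro s hs
        have hs0 := hsub s hs
        exact (((hasDerivAt_flowScale hn0 hr h1 h2 (hτnn s hs0)).continuousAt.comp
          (hd s hs0).continuousAt).pow _).continuousWithinAt
      · refine (continuousOn_flowErr hn0 hr h1 h2).sqrt.mono ?_
        rintro _ ⟨s, hs, rfl⟩
        exact hτnn s (hsub s hs)
    calc _ = (n - 1) * ∫ x in τ 0..τ t, √(flowErr n r ν x) := by rw [← this]; rfl
      _ ≤ _ := by
        rw [hτ0]
        exact integral_sqrt_flowErr_le hn hr hr1 h1 h2 (hτnn t ht)

end RadialFlow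

section MatrixCalculus

/-- Frobenius inner product. -/
def frobInner {p q : ℕ} (A B : Matrix (Fin p) (Fin q) ℝ) : ℝ := ∑ i, ∑ j, A i j * B i j

section FrobeniusInstance

open scoped Matrix.Norms.Frobenius

lemma frobNorm_eq_norm {p q : ℕ} (M : Matrix (Fin p) (Fin q) ℝ) : frobNorm M = ‖M‖ := by
  rw [Matrix.frobenius_norm_def, frobNorm, Real.sqrt_eq_rpow]
  simp

lemma frobNorm_mul_le {p q s : ℕ} (A : Matrix (Fin p) (Fin q) ℝ) (B : Matrix (Fin q) (Fin s) ℝ) :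
    frobNorm (A * B) ≤ frobNorm A * frobNorm B := by
  simpa only [frobNorm_eq_norm] using Matrix.frobenius_norm_mul A B

lemma frobNorm_add_le {p q : ℕ} (A B : Matrix (Fin p) (Fin q) ℝ) :
    frobNorm (A + B) ≤ frobNorm A + frobNorm B := by
  simpa only [frobNorm_eq_norm] using norm_add_le A B

lemma frobNorm_sub_le {p q : ℕ} (A B : Matrix (Fin p) (Fin q) ℝ) :
    frobNorm (A - B) ≤ frobNorm A + frobNorm B := by
  simpa only [frobNorm_eq_norm] using norm_sub_le A B

@[simp] lemma frobNorm_zero {p q : ℕ} : frobNorm (0 : Matrix (Fin p) (Fin q) ℝ) = 0 := by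
  rw [frobNorm_eq_norm, norm_zero]

end FrobeniusInstance

lemma frobNorm_nonneg {p q : ℕ} (M : Matrix (Fin p) (Fin q) ℝ) : 0 ≤ frobNorm M :=
  Real.sqrt_nonneg _

lemma frobNorm_sq {p q : ℕ} (M : Matrix (Fin p) (Fin q) ℝ) :
    frobNorm M ^ 2 = ∑ i, ∑ j, M i j ^ 2 :=
  Real.sq_sqrt (Finset.sum_nonneg fun _ _ => Finset.sum_nonneg fun _ _ => sq_nonneg _)

lemma abs_frobInner_le {p q : ℕ} (A B : Matrix (Fin p) (Fin q) ℝ) :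
    |frobInner A B| ≤ frobNorm A * frobNorm B := by
  apply abs_le_of_sq_le_sq _ (mul_nonneg (frobNorm_nonneg A) (frobNorm_nonneg B))
  rw [mul_pow, frobNorm_sq, frobNorm_sq, frobInner]
  simp only [← Fintype.sum_prod_type']
  exact Finset.sum_mul_sq_le_sq_mul_sq _ _ _

lemma frobInner_self {p q : ℕ} (A : Matrix (Fin p) (Fin q) ℝ) :
    frobInner A A = frobNorm A ^ 2 := by
  rw [frobNorm_sq]; simp [frobInner, sq]

variable {n : ℕ} {dims : ℕ → ℕ}

/-- Directional derivative of the partial product `segProd dims W 0 b` in the direction `V`. -/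
def segDeriv (dims : ℕ → ℕ) (W V : WeightFam n dims) :
    (b : ℕ) → Matrix (Fin (dims b)) (Fin (dims 0)) ℝ
  | 0 => 0
  | b + 1 =>
      if hb : b < n then V ⟨b, hb⟩ * segProd dims W 0 b + W ⟨b, hb⟩ * segDeriv dims W V b else 0

/-- Second directional derivative of the partial product `segProd dims W 0 b`. -/
def segDeriv₂ (dims : ℕ → ℕ) (W U V : WeightFam n dims) :
    (b : ℕ) → Matrix (Fin (dims b)) (Fin (dims 0)) ℝ
  | 0 => 0
  | b + 1 =>
      if hb : b < n then
        U ⟨b, hb⟩ * segDeriv dims W V b + V ⟨b, hb⟩ * segDeriv dims W U b +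
          W ⟨b, hb⟩ * segDeriv₂ dims W U V b
      else 0

lemma segProd_zero_zero (W : WeightFam n dims) : segProd dims W 0 0 = 1 := by
  ext i j
  simp [segProd, castId, Matrix.one_apply, Fin.ext_iff]

lemma segProd_zero_succ (W : WeightFam n dims) {b : ℕ} (hb : b < n) :
    segProd dims W 0 (b + 1) = W ⟨b, hb⟩ * segProd dims W 0 b := by
  simp [segProd, hb]

lemma segDeriv_succ (W V : WeightFam n dims) {b : ℕ} (hb : b < n) :
    segDeriv dims W V (b + 1) =
      V ⟨b, hb⟩ * segProd dims W 0 b + W ⟨b, hb⟩ * segDeriv dims W V b := by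
  simp [segDeriv, hb]

lemma segDeriv₂_succ (W U V : WeightFam n dims) {b : ℕ} (hb : b < n) :
    segDeriv₂ dims W U V (b + 1) =
      U ⟨b, hb⟩ * segDeriv dims W V b + V ⟨b, hb⟩ * segDeriv dims W U b +
          W ⟨b, hb⟩ * segDeriv₂ dims W U V b := by
  simp [segDeriv₂, hb]

lemma hasDerivAt_mul_apply {p q s : ℕ} {A : ℝ → Matrix (Fin p) (Fin q) ℝ}
    {B : ℝ → Matrix (Fin q) (Fin s) ℝ} {A' : Matrix (Fin p) (Fin q) ℝ}
    {B' : Matrix (Fin q) (Fin s) ℝ} {x : ℝ}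
    (hA : ∀ i j, HasDerivAt (fun t => A t i j) (A' i j) x)
    (hB : ∀ i j, HasDerivAt (fun t => B t i j) (B' i j) x) (i : Fin p) (j : Fin s) :
    HasDerivAt (fun t => (A t * B t) i j) ((A' * B x + A x * B') i j) x := by
  simp only [Matrix.mul_apply, Matrix.add_apply, ← Finset.sum_add_distrib]
  exact HasDerivAt.fun_sum fun k _ => (hA i k).mul (hB k j)

lemma hasDerivAt_segProd {W : ℝ → WeightFam n dims} {V : WeightFam n dims} {x : ℝ}
    (hW : ∀ j p q, HasDerivAt (fun t => W t j p q) (V j p q) x) {b : ℕ} (hb : b ≤ n)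
    (i : Fin (dims b)) (k : Fin (dims 0)) :
    HasDerivAt (fun t => segProd dims (W t) 0 b i k) (segDeriv dims (W x) V b i k) x := by
  induction b generalizing k with
  | zero =>
    simp only [segProd_zero_zero]
    exact hasDerivAt_const x _
  | succ b ih =>
    have hb' : b < n := hb
    simp only [segProd_zero_succ _ hb', segDeriv_succ _ _ hb']
    exact hasDerivAt_mul_apply (hW ⟨b, hb'⟩) (fun i k => ih hb'.le i k) i k

lemma hasDerivAt_segDeriv {W : ℝ → WeightFam n dims} {U V : WeightFam n dims} {x : ℝ}
    (hW : ∀ j p q, HasDerivAt (fun t => W t j p q) (V j p q) x) {b : ℕ} (hb : b ≤ n)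
    (i : Fin (dims b)) (k : Fin (dims 0)) :
    HasDerivAt (fun t => segDeriv dims (W t) U b i k) (segDeriv₂ dims (W x) U V b i k) x := by
  induction b generalizing k with
  | zero => exact hasDerivAt_const x _
  | succ b ih =>
    have hb' : b < n := hb
    simp only [segDeriv_succ _ _ hb', segDeriv₂_succ _ _ _ hb']
    have e1 := hasDerivAt_mul_apply (A := fun _ => U ⟨b, hb'⟩) (A' := 0)
      (fun i j => hasDerivAt_const x (U ⟨b, hb'⟩ i j))
      (fun i k => hasDerivAt_segProd hW hb'.le i k) i k
    have e2 := hasDerivAt_mul_apply (hW ⟨b, hb'⟩) (fun i k => ih hb'.le i k) i k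
    refine (e1.add e2).congr_deriv ?_
    simp only [Matrix.add_apply, Matrix.zero_mul, Matrix.zero_apply]
    ring

/-- Frobenius norm of a layer, extended by zero to all natural indices. -/
def layerNorm (V : WeightFam n dims) (j : ℕ) : ℝ := if hj : j < n then frobNorm (V ⟨j, hj⟩) else 0

lemma layerNorm_nonneg (V : WeightFam n dims) (j : ℕ) : 0 ≤ layerNorm V j := by
  unfold layerNorm; split
  · exact frobNorm_nonneg _
  · exact le_rfl

lemma sum_range_layerNorm (V : WeightFam n dims) (φ : ℝ → ℝ) :
    ∑ j ∈ Finset.range n, φ (layerNorm V j) = ∑ j, φ (frobNorm (V j)) := by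
  rw [Finset.sum_range]
  simp [layerNorm]

section Bounds

variable {W U V : WeightFam n dims} {ρ : ℝ}

lemma frobNorm_mul_segProd_le (hW : ∀ j, frobNorm (W j) ≤ ρ) (hρ : 0 ≤ ρ)
    {b : ℕ} (hb : b ≤ n) {p : ℕ} (M : Matrix (Fin p) (Fin (dims b)) ℝ) :
    frobNorm (M * segProd dims W 0 b) ≤ frobNorm M * ρ ^ b := by
  induction b generalizing p with
  | zero => rw [segProd_zero_zero, Matrix.mul_one, pow_zero, mul_one]
  | succ b ih =>
    have hb' : b < n := hb
    rw [segProd_zero_succ _ hb', ← Matrix.mul_assoc]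
    calc _ ≤ frobNorm (M * W ⟨b, hb'⟩) * ρ ^ b := ih hb'.le _
      _ ≤ frobNorm M * ρ * ρ ^ b := by
        gcongr
        exact (frobNorm_mul_le _ _).trans
          (mul_le_mul_of_nonneg_left (hW _) (frobNorm_nonneg _))
      _ = _ := by ring

lemma frobNorm_segProd_le (hW : ∀ j, frobNorm (W j) ≤ ρ) (hρ : 0 ≤ ρ)
    {b : ℕ} (hb : b ≤ n) (hb0 : b ≠ 0) : frobNorm (segProd dims W 0 b) ≤ ρ ^ b := by
  obtain ⟨b, rfl⟩ := Nat.exists_eq_succ_of_ne_zero hb0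
  have hb' : b < n := hb
  rw [Nat.succ_eq_add_one, segProd_zero_succ _ hb', pow_succ']
  exact (frobNorm_mul_segProd_le hW hρ hb'.le _).trans
    (mul_le_mul_of_nonneg_right (hW _) (by positivity))

lemma mul_frobNorm_segDeriv_le (hW : ∀ j, frobNorm (W j) ≤ ρ) (hρ : 0 ≤ ρ)
    {b : ℕ} (hb : b ≤ n) :
    ρ * frobNorm (segDeriv dims W V b) ≤ ρ ^ b * ∑ j ∈ Finset.range b, layerNorm V j := by
  induction b with
  | zero => simp [segDeriv]
  | succ b ih =>
    have hb' : b < n := hb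
    rw [segDeriv_succ _ _ hb', Finset.sum_range_succ]
    have e : layerNorm V b = frobNorm (V ⟨b, hb'⟩) := by simp [layerNorm, hb']
    have h1 := frobNorm_mul_segProd_le hW hρ hb'.le (V ⟨b, hb'⟩)
    have h2 : frobNorm (W ⟨b, hb'⟩ * segDeriv dims W V b) ≤ ρ * frobNorm (segDeriv dims W V b) :=
      (frobNorm_mul_le _ _).trans (mul_le_mul_of_nonneg_right (hW _) (frobNorm_nonneg _))
    rw [e]
    calc _ ≤ ρ * (frobNorm (V ⟨b, hb'⟩) * ρ ^ b + ρ ^ b * ∑ j ∈ Finset.range b, layerNorm V j) := by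
          gcongr
          exact (frobNorm_add_le _ _).trans (add_le_add h1 (h2.trans (ih hb'.le)))
      _ = _ := by ring

lemma sq_mul_frobNorm_segDeriv₂_le (hW : ∀ j, frobNorm (W j) ≤ ρ) (hρ : 0 ≤ ρ)
    {b : ℕ} (hb : b ≤ n) :
    ρ ^ 2 * frobNorm (segDeriv₂ dims W U V b) ≤
      ρ ^ b * ((∑ j ∈ Finset.range b, layerNorm U j) * (∑ j ∈ Finset.range b, layerNorm V j) -
        ∑ j ∈ Finset.range b, layerNorm U j * layerNorm V j) := by
  induction b with
  | zero => simp [segDeriv₂]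
  | succ b ih =>
    have hb' : b < n := hb
    rw [segDeriv₂_succ _ _ _ hb']
    simp only [Finset.sum_range_succ]
    have eU : layerNorm U b = frobNorm (U ⟨b, hb'⟩) := by simp [layerNorm, hb']
    have eV : layerNorm V b = frobNorm (V ⟨b, hb'⟩) := by simp [layerNorm, hb']
    have h1 := frobNorm_mul_le (U ⟨b, hb'⟩) (segDeriv dims W V b)
    have h2 := frobNorm_mul_le (V ⟨b, hb'⟩) (segDeriv dims W U b)
    have h3 : frobNorm (W ⟨b, hb'⟩ * segDeriv₂ dims W U V b) ≤
        ρ * frobNorm (segDeriv₂ dims W U V b) :=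
      (frobNorm_mul_le _ _).trans (mul_le_mul_of_nonneg_right (hW _) (frobNorm_nonneg _))
    have hdU := mul_frobNorm_segDeriv_le (V := U) hW hρ hb'.le
    have hdV := mul_frobNorm_segDeriv_le (V := V) hW hρ hb'.le
    have h := ih hb'.le
    have hU0 := layerNorm_nonneg U b
    have hV0 := layerNorm_nonneg V b
    rw [← eU] at h1
    rw [← eV] at h2
    set SU := ∑ j ∈ Finset.range b, layerNorm U j
    set SV := ∑ j ∈ Finset.range b, layerNorm V j
    set SUV := ∑ j ∈ Finset.range b, layerNorm U j * layerNorm V j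
    calc _ ≤ ρ ^ 2 * (layerNorm U b * frobNorm (segDeriv dims W V b) +
            layerNorm V b * frobNorm (segDeriv dims W U b) +
            ρ * frobNorm (segDeriv₂ dims W U V b)) := by
          gcongr
          refine (frobNorm_add_le _ _).trans (add_le_add ?_ h3)
          exact (frobNorm_add_le _ _).trans (add_le_add h1 h2)
      _ = ρ * layerNorm U b * (ρ * frobNorm (segDeriv dims W V b)) +
            ρ * layerNorm V b * (ρ * frobNorm (segDeriv dims W U b)) +
            ρ * (ρ ^ 2 * frobNorm (segDeriv₂ dims W U V b)) := by ring
      _ ≤ ρ * layerNorm U b * (ρ ^ b * SV) + ρ * layerNorm V b * (ρ ^ b * SU) +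
            ρ * (ρ ^ b * (SU * SV - SUV)) := by gcongr
      _ = _ := by ring

lemma frobNorm_segProd_sub_le {W' : WeightFam n dims} {ε : ℝ} (hW : ∀ j, frobNorm (W j) ≤ ρ)
    (hρ : 0 ≤ ρ) (hε : ∀ j, frobNorm (W' j - W j) ≤ ε) (hε0 : 0 ≤ ε) {b : ℕ} (hb : b ≤ n) :
    frobNorm (segProd dims W' 0 b - segProd dims W 0 b) ≤ (ρ + ε) ^ b - ρ ^ b := by
  induction b with
  | zero => simp [segProd_zero_zero]
  | succ b ih =>
    have hb' : b < n := hb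
    have hW' : frobNorm (W' ⟨b, hb'⟩) ≤ ρ + ε := by
      have := frobNorm_add_le (W ⟨b, hb'⟩) (W' ⟨b, hb'⟩ - W ⟨b, hb'⟩)
      rw [add_sub_cancel] at this
      linarith [hW ⟨b, hb'⟩, hε ⟨b, hb'⟩]
    rw [segProd_zero_succ _ hb', segProd_zero_succ _ hb']
    have e : W' ⟨b, hb'⟩ * segProd dims W' 0 b - W ⟨b, hb'⟩ * segProd dims W 0 b =
        (W' ⟨b, hb'⟩ - W ⟨b, hb'⟩) * segProd dims W 0 b +
          W' ⟨b, hb'⟩ * (segProd dims W' 0 b - segProd dims W 0 b) := by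
      rw [Matrix.sub_mul, Matrix.mul_sub]; abel
    rw [e]
    have h1 : frobNorm ((W' ⟨b, hb'⟩ - W ⟨b, hb'⟩) * segProd dims W 0 b) ≤ ε * ρ ^ b :=
      (frobNorm_mul_segProd_le hW hρ hb'.le _).trans
        (mul_le_mul_of_nonneg_right (hε _) (by positivity))
    have h2 : frobNorm (W' ⟨b, hb'⟩ * (segProd dims W' 0 b - segProd dims W 0 b)) ≤
        (ρ + ε) * ((ρ + ε) ^ b - ρ ^ b) :=
      (frobNorm_mul_le _ _).trans
        (mul_le_mul hW' (ih hb'.le) (frobNorm_nonneg _) (by positivity))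
    calc _ ≤ ε * ρ ^ b + (ρ + ε) * ((ρ + ε) ^ b - ρ ^ b) :=
          (frobNorm_add_le _ _).trans (add_le_add h1 h2)
      _ = _ := by ring

end Bounds

lemma add_pow_sub_pow_le {x ε : ℝ} (hx : 0 ≤ x) (hx1 : x ≤ 1) (hε : 0 ≤ ε) (k : ℕ) :
    (x + ε) ^ k - x ^ k ≤ k * ε * (1 + ε) ^ k := by
  induction k with
  | zero => simp
  | succ k ih =>
    have h1 : x ^ k ≤ (1 + ε) ^ (k + 1) :=
      (pow_le_one₀ hx hx1).trans (one_le_pow₀ (by linarith))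
    have h2 : (x + ε) * ((x + ε) ^ k - x ^ k) ≤ (1 + ε) * (k * ε * (1 + ε) ^ k) := by
      have : 0 ≤ (x + ε) ^ k - x ^ k := by
        have := pow_le_pow_left₀ hx (by linarith : x ≤ x + ε) k
        linarith
      gcongr
    calc (x + ε) ^ (k + 1) - x ^ (k + 1) = (x + ε) * ((x + ε) ^ k - x ^ k) + ε * x ^ k := by ring
      _ ≤ (1 + ε) * (k * ε * (1 + ε) ^ k) + ε * (1 + ε) ^ (k + 1) := by gcongr
      _ = _ := by push_cast; ring

lemma one_add_pow_le {ε : ℝ} (hε : 0 ≤ ε) {k n : ℕ} (hk : k ≤ n) (hn : n * ε ≤ 1 / 2) :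
    (1 + ε) ^ k ≤ 5 / 3 := by
  have h1 : (1 + ε) ^ k ≤ Real.exp (1 / 2) := by
    calc (1 + ε) ^ k ≤ (1 + ε) ^ n := pow_le_pow_right₀ (by linarith) hk
      _ ≤ Real.exp ε ^ n := by
        gcongr; linarith [Real.add_one_le_exp ε]
      _ = Real.exp (n * ε) := (Real.exp_nat_mul _ _).symm
      _ ≤ _ := Real.exp_le_exp.2 hn
  have h2 : Real.exp (1 / 2) ^ 2 ≤ (5 / 3) ^ 2 := by
    rw [← Real.exp_nat_mul]
    norm_num
    linarith [Real.exp_one_lt_d9]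
  exact h1.trans (le_of_sq_le_sq h2 (by norm_num))

end MatrixCalculus

section BalancedRays

variable {n : ℕ} {dims : ℕ → ℕ}

lemma frobNorm_smul_vecMulVec {p q : ℕ} (s : ℝ) (hs : 0 ≤ s) {x : Fin p → ℝ} {y : Fin q → ℝ}
    (hx : x ⬝ᵥ x = 1) (hy : y ⬝ᵥ y = 1) : frobNorm (s • vecMulVec x y) = s := by
  have : ∑ i, ∑ j, (s • vecMulVec x y) i j ^ 2 = s ^ 2 := by
    have e : ∀ i j, (s • vecMulVec x y) i j ^ 2 = s ^ 2 * ((x i * x i) * (y j * y j)) := by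
      intro i j
      simp only [Matrix.smul_apply, vecMulVec_apply, smul_eq_mul]; ring
    simp only [e, ← Finset.mul_sum, ← Finset.sum_mul]
    simp only [dotProduct] at hx hy
    rw [hx, hy]; ring
  rw [frobNorm, this, Real.sqrt_sq hs]

lemma exists_eq_smul_vecMulVec {p q : ℕ} {A : Matrix (Fin p) (Fin q) ℝ} {v : Fin p → ℝ} {σ : ℝ}
    (hv : v ⬝ᵥ v = 1) (hσ : 0 < σ) (hA : A * Aᵀ = σ ^ 2 • vecMulVec v v) :
    ∃ u : Fin q → ℝ, u ⬝ᵥ u = 1 ∧ A = σ • vecMulVec v u := by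
  refine ⟨σ⁻¹ • (v ᵥ* A), ?_, ?_⟩
  · have : (v ᵥ* A) ⬝ᵥ (v ᵥ* A) = σ ^ 2 := by
      rw [← dotProduct_mulVec, ← Matrix.mulVec_transpose, Matrix.mulVec_mulVec, hA,
        Matrix.smul_mulVec, Matrix.vecMulVec_mulVec, dotProduct_smul]
      simp [hv]
    rw [smul_dotProduct, dotProduct_smul, this]
    simp only [smul_eq_mul]; field_simp
  · have hN : (A - vecMulVec v (v ᵥ* A)) * (A - vecMulVec v (v ᵥ* A))ᵀ = 0 := by
      have e : A - vecMulVec v (v ᵥ* A) = (1 - vecMulVec v v) * A := by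
        rw [Matrix.sub_mul, Matrix.one_mul, Matrix.vecMulVec_mul]
      have e0 : (1 - vecMulVec v v) * vecMulVec v v = 0 := by
        rw [Matrix.sub_mul, Matrix.one_mul, Matrix.vecMulVec_mul_vecMulVec, hv]
        simp
      rw [e, Matrix.transpose_mul, Matrix.mul_assoc, ← Matrix.mul_assoc A, hA, Matrix.smul_mul,
        Matrix.mul_smul, ← Matrix.mul_assoc, e0]
      simp
    have h0 : A - vecMulVec v (v ᵥ* A) = 0 := by
      rw [← Matrix.conjTranspose_eq_transpose_of_trivial] at hN
      exact Matrix.self_mul_conjTranspose_eq_zero.1 hN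
    rw [Matrix.vecMulVec_smul, smul_smul, mul_inv_cancel₀ hσ.ne', one_smul]
    exact sub_eq_zero.1 h0

/-- Layers of a balanced network with scalar output are aligned rank-one matrices of equal
norm. -/
lemma exists_rays_of_isBalanced (hn : n ≠ 0) (hdn : dims n = 1) {W : WeightFam n dims}
    (hbal : IsBalanced dims W) (hpos : 0 < frobNorm (segProd dims W 0 n)) :
    ∃ (σ : ℝ) (a : ∀ k, Fin (dims k) → ℝ), 0 < σ ∧ a n = 1 ∧ (∀ k ≤ n, a k ⬝ᵥ a k = 1) ∧
      ∀ j (hj : j < n), W ⟨j, hj⟩ = σ • vecMulVec (a (j + 1)) (a j) := by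
  obtain ⟨m, rfl⟩ := Nat.exists_eq_succ_of_ne_zero hn
  have hm : m < m + 1 := Nat.lt_succ_self m
  set σ := frobNorm (W ⟨m, hm⟩) with hσ
  have hσ0 : 0 < σ := by
    refine (frobNorm_nonneg _).lt_of_ne' fun h0 => ?_
    have hle := frobNorm_mul_le (W ⟨m, hm⟩) (segProd dims W 0 m)
    rw [h0, zero_mul] at hle
    rw [show segProd dims W 0 m.succ = _ from segProd_zero_succ W hm] at hpos
    linarith
  have : Unique (Fin (dims (m + 1))) := by
    rw [show dims (m + 1) = 1 from hdn]; infer_instance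
  have hone : ∀ x : Fin (dims (m + 1)) → ℝ, x = 1 → x ⬝ᵥ x = 1 := by
    rintro _ rfl
    simp [dotProduct]
  have key : ∀ k ≤ m + 1, ∃ a : ∀ k, Fin (dims k) → ℝ, a (m + 1) = 1 ∧
      (∀ i, k ≤ i → i ≤ m + 1 → a i ⬝ᵥ a i = 1) ∧
      ∀ j (hj : j < m + 1), k ≤ j → W ⟨j, hj⟩ = σ • vecMulVec (a (j + 1)) (a j) := by
    intro k hk
    induction hk using Nat.decreasingInduction with
    | self =>
      refine ⟨fun _ => 1, rfl, fun i h1 h2 => ?_, fun j hj h => absurd hj (by omega)⟩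
      obtain rfl : i = m + 1 := le_antisymm h2 h1
      exact hone _ rfl
    | of_succ k hk ih =>
      obtain ⟨a, ha1, hau, haW⟩ := ih
      have hk' : k < m + 1 := hk
      have hA : W ⟨k, hk'⟩ * (W ⟨k, hk'⟩)ᵀ = σ ^ 2 • vecMulVec (a (k + 1)) (a (k + 1)) := by
        rcases Nat.lt_or_ge (k + 1) (m + 1) with h | h
        · rw [← hbal k h, haW (k + 1) h le_rfl, Matrix.transpose_smul, Matrix.smul_mul,
            Matrix.mul_smul, smul_smul, ← sq, Matrix.transpose_vecMulVec,
            Matrix.vecMulVec_mul_vecMulVec, hau (k + 1 + 1) (by omega) (by omega), one_smul]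
        · obtain rfl : k = m := by omega
          ext i j
          rw [Subsingleton.elim i default, Subsingleton.elim j default, hσ, frobNorm_sq, ha1]
          simp [Matrix.mul_apply, sq]
      obtain ⟨u, hu1, hu2⟩ := exists_eq_smul_vecMulVec (hau (k + 1) le_rfl hk) hσ0 hA
      refine ⟨Function.update a k u, ?_, fun i h1 h2 => ?_, fun j hj h => ?_⟩
      · rw [Function.update_of_ne (by omega), ha1]
      · rcases h1.eq_or_lt with rfl | h
        · rwa [Function.update_self]
        · rw [Function.update_of_ne (by omega)]
          exact hau i h h2
      · rcases h.eq_or_lt with rfl | h'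
        · rw [Function.update_of_ne (by omega), Function.update_self]
          exact hu2
        · rw [Function.update_of_ne (by omega), Function.update_of_ne (by omega)]
          exact haW j hj h'
  obtain ⟨a, h1, h2, h3⟩ := key 0 (Nat.zero_le _)
  exact ⟨σ, a, hσ0, h1, fun k hk => h2 k (Nat.zero_le _) hk, fun j hj => h3 j hj (Nat.zero_le _)⟩

/-- Aligned rank-one layers: all layers but the first are `s` times a fixed rank-one matrix, and
the first one has row space spanned by `p`. -/
def rayFam (n : ℕ) (a : ∀ k, Fin (dims k) → ℝ) (s : ℝ) (p : Fin (dims 0) → ℝ) :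
    WeightFam n dims := fun j =>
  vecMulVec (a (j + 1)) (Function.update (fun k => s • a k) 0 p (j : ℕ))

variable {a : ∀ k, Fin (dims k) → ℝ} {s : ℝ} {p u : Fin (dims 0) → ℝ}

lemma rayFam_zero (h0 : 0 < n) : rayFam n a s p ⟨0, h0⟩ = vecMulVec (a (0 + 1)) p := by
  simp [rayFam]

lemma rayFam_succ {j : ℕ} (hj : j + 1 < n) :
    rayFam n a s p ⟨j + 1, hj⟩ = s • vecMulVec (a (j + 1 + 1)) (a (j + 1)) := by
  rw [rayFam, Function.update_of_ne (Nat.succ_ne_zero j), Matrix.vecMulVec_smul]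

lemma frobNorm_rayFam (hs : 0 ≤ s) (ha : ∀ k, k ≠ 0 → k ≤ n → a k ⬝ᵥ a k = 1) (hu : u ⬝ᵥ u = 1)
    (j : Fin n) : frobNorm (rayFam n a s (s • u) j) = s := by
  obtain ⟨j, hj⟩ := j
  cases j with
  | zero =>
    rw [rayFam_zero, Matrix.vecMulVec_smul]
    exact frobNorm_smul_vecMulVec s hs (ha 1 one_ne_zero hj) hu
  | succ j =>
    rw [rayFam_succ]
    exact frobNorm_smul_vecMulVec s hs (ha _ (Nat.succ_ne_zero _) hj)
      (ha _ (Nat.succ_ne_zero _) hj.le)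

lemma segProd_rayFam (ha : ∀ k, k ≠ 0 → k ≤ n → a k ⬝ᵥ a k = 1) {k : ℕ} (hk : k < n) :
    segProd dims (rayFam n a s p) 0 (k + 1) = s ^ k • vecMulVec (a (k + 1)) p := by
  induction k with
  | zero =>
    rw [segProd_zero_succ _ hk, segProd_zero_zero, rayFam_zero, Matrix.mul_one, pow_zero, one_smul]
  | succ k ih =>
    rw [segProd_zero_succ _ hk, ih (by omega), rayFam_succ, Matrix.smul_mul, Matrix.mul_smul,
      Matrix.vecMulVec_mul_vecMulVec, ha (k + 1) (by omega) hk.le, one_smul, smul_smul, pow_succ']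

/-- Component of the layer `V j` along the rank-one matrix `a (j + 1) (a j)ᵀ`. -/
def rayCoeff (a : ∀ k, Fin (dims k) → ℝ) (V : WeightFam n dims) (j : ℕ) : ℝ :=
  if hj : j < n then (a (j + 1) ᵥ* V ⟨j, hj⟩) ⬝ᵥ a j else 0

lemma vecMul_segDeriv_rayFam (ha : ∀ k, k ≠ 0 → k ≤ n → a k ⬝ᵥ a k = 1) (V : WeightFam n dims)
    {k : ℕ} (hk : k < n) :
    a (k + 1) ᵥ* segDeriv dims (rayFam n a s (s • u)) V (k + 1) =
      s ^ k • (a (0 + 1) ᵥ* V ⟨0, by omega⟩ +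
        (∑ j ∈ Finset.range k, rayCoeff a V (j + 1)) • u) := by
  induction k with
  | zero =>
    rw [segDeriv_succ _ _ hk, segProd_zero_zero]
    simp [segDeriv]
  | succ k ih =>
    have ih' := ih (by omega)
    have hc : rayCoeff a V (k + 1) = (a (k + 1 + 1) ᵥ* V ⟨k + 1, hk⟩) ⬝ᵥ a (k + 1) := by
      simp [rayCoeff, hk]
    rw [segDeriv_succ _ _ hk, segProd_rayFam ha (by omega), rayFam_succ, Matrix.vecMul_add,
      Matrix.smul_mul, Matrix.vecMulVec_mul, ih', Finset.sum_range_succ, hc,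
      Matrix.vecMul_smul, Matrix.vecMul_vecMulVec, ha (k + 1 + 1) (by omega) hk,
      Matrix.mul_smul, Matrix.mul_vecMulVec, Matrix.vecMul_smul, Matrix.vecMul_vecMulVec,
      dotProduct_mulVec]
    ext i
    simp only [Pi.add_apply, Pi.smul_apply, smul_eq_mul]
    simp only [pow_succ]
    ring

lemma frobInner_vecMulVec {p q : ℕ} (V : Matrix (Fin p) (Fin q) ℝ) (x : Fin p → ℝ)
    (y : Fin q → ℝ) : frobInner V (vecMulVec x y) = (x ᵥ* V) ⬝ᵥ y := by
  simp only [frobInner, vecMulVec_apply, dotProduct, Matrix.vecMul, Finset.sum_mul]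
  rw [Finset.sum_comm]
  exact Finset.sum_congr rfl fun j _ => Finset.sum_congr rfl fun i _ => by ring

lemma sum_frobInner_rayFam {m : ℕ} (V : WeightFam (m + 1) dims) :
    ∑ j, frobInner (V j) (rayFam (m + 1) a s p j) =
      (a (0 + 1) ᵥ* V ⟨0, m.succ_pos⟩) ⬝ᵥ p +
        s * ∑ j ∈ Finset.range m, rayCoeff a V (j + 1) := by
  rw [Fin.sum_univ_succ, Finset.sum_range, Finset.mul_sum]
  congr 1
  · exact (congrArg _ (rayFam_zero m.succ_pos)).trans (frobInner_vecMulVec _ _ _)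
  · refine Finset.sum_congr rfl fun j _ => ?_
    have hj : (j : ℕ) + 1 < m + 1 := by omega
    have h1 : rayCoeff a V (j + 1) = (a (j + 1 + 1) ᵥ* V ⟨j + 1, hj⟩) ⬝ᵥ a (j + 1) := by
      simp [rayCoeff]
    have h2 : rayFam (m + 1) a s p j.succ = vecMulVec (a (j + 1 + 1)) (s • a (j + 1)) :=
      (rayFam_succ hj).trans (Matrix.vecMulVec_smul _ _ _).symm
    rw [h2, frobInner_vecMulVec, dotProduct_smul, h1]
    rfl

lemma frobInner_eq_of_unique {p q : ℕ} [Unique (Fin p)] (A B : Matrix (Fin p) (Fin q) ℝ) :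
    frobInner A B = ((1 : Fin p → ℝ) ᵥ* A) ⬝ᵥ ((1 : Fin p → ℝ) ᵥ* B) := by
  simp [frobInner, dotProduct, Matrix.vecMul]

end BalancedRays

section TrainingLoss

variable {n d : ℕ} {dims : ℕ → ℕ} {arr : EuclideanSpace ℝ (Fin d) →ₗ[ℝ] WeightFam n dims}

lemma contDiff_arr_apply (arr : EuclideanSpace ℝ (Fin d) →ₗ[ℝ] WeightFam n dims) (j : Fin n)
    (p : Fin (dims (j + 1))) (q : Fin (dims j)) : ContDiff ℝ 2 fun θ => arr θ j p q := by
  let L : EuclideanSpace ℝ (Fin d) →ₗ[ℝ] ℝ :=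
    { toFun := fun θ => arr θ j p q
      map_add' := fun x y => by simp
      map_smul' := fun c x => by simp }
  exact L.toContinuousLinearMap.contDiff

lemma contDiff_segProd (arr : EuclideanSpace ℝ (Fin d) →ₗ[ℝ] WeightFam n dims) {b : ℕ} (hb : b ≤ n)
    (i : Fin (dims b)) (k : Fin (dims 0)) :
    ContDiff ℝ 2 fun θ => segProd dims (arr θ) 0 b i k := by
  induction b generalizing k with
  | zero =>
    simp only [segProd_zero_zero]
    exact contDiff_const
  | succ b ih =>
    have hb' : b < n := hb
    simp only [segProd_zero_succ _ hb', Matrix.mul_apply]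
    exact ContDiff.sum fun l _ => (contDiff_arr_apply arr ⟨b, hb'⟩ i l).mul (ih hb'.le l k)

variable {Λ : Matrix (Fin (dims n)) (Fin (dims 0)) ℝ} {f : EuclideanSpace ℝ (Fin d) → ℝ} {c : ℝ}

lemma contDiff_loss (hf : ∀ θ, f θ = 1 / 2 * frobNorm (segProd dims (arr θ) 0 n - Λ) ^ 2 + c) :
    ContDiff ℝ 2 f := by
  rw [funext hf]
  simp only [frobNorm_sq, Matrix.sub_apply]
  refine (contDiff_const.mul (ContDiff.sum fun i _ => ContDiff.sum fun k _ => ?_)).add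
    contDiff_const
  exact ((contDiff_segProd arr le_rfl i k).sub contDiff_const).pow 2

lemma hasDerivAt_arr_line (θ v : EuclideanSpace ℝ (Fin d)) (j : Fin n) (p : Fin (dims (j + 1)))
    (q : Fin (dims j)) :
    HasDerivAt (fun s : ℝ => arr (θ + s • v) j p q) (arr v j p q) 0 := by
  simp only [map_add, map_smul, Pi.add_apply, Pi.smul_apply, Matrix.add_apply, Matrix.smul_apply,
    smul_eq_mul]
  simpa using ((hasDerivAt_id (0 : ℝ)).mul_const (arr v j p q)).const_add (arr θ j p q)

lemma hasDerivAt_line (θ v : EuclideanSpace ℝ (Fin d)) :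
    HasDerivAt (fun s : ℝ => θ + s • v) v 0 := by
  simpa using ((hasDerivAt_id (0 : ℝ)).smul_const v).const_add θ

lemma hasDerivAt_frobInner {p q : ℕ} {A B : ℝ → Matrix (Fin p) (Fin q) ℝ}
    {A' B' : Matrix (Fin p) (Fin q) ℝ} {x : ℝ}
    (hA : ∀ i j, HasDerivAt (fun t => A t i j) (A' i j) x)
    (hB : ∀ i j, HasDerivAt (fun t => B t i j) (B' i j) x) :
    HasDerivAt (fun t => frobInner (A t) (B t)) (frobInner A' (B x) + frobInner (A x) B') x := by
  simp only [frobInner, ← Finset.sum_add_distrib]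
  exact HasDerivAt.fun_sum fun i _ => HasDerivAt.fun_sum fun j _ => (hA i j).mul (hB i j)

lemma frobInner_comm {p q : ℕ} (A B : Matrix (Fin p) (Fin q) ℝ) :
    frobInner A B = frobInner B A := by
  simp only [frobInner, mul_comm]

lemma inner_gradient_loss
    (hf : ∀ θ, f θ = 1 / 2 * frobNorm (segProd dims (arr θ) 0 n - Λ) ^ 2 + c)
    (θ u : EuclideanSpace ℝ (Fin d)) :
    ⟪gradient f θ, u⟫ =
      frobInner (segProd dims (arr θ) 0 n - Λ) (segDeriv dims (arr θ) (arr u) n) := by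
  have h1 : ⟪gradient f θ, u⟫ = fderiv ℝ f θ u := InnerProductSpace.toDual_symm_apply
  have hd : HasFDerivAt f (fderiv ℝ f θ) (θ + (0 : ℝ) • u) := by
    rw [zero_smul, add_zero]
    exact ((contDiff_loss hf).differentiable (by norm_num) θ).hasFDerivAt
  have h2 := hd.comp_hasDerivAt (0 : ℝ) (hasDerivAt_line θ u)
  have hP : ∀ i k, HasDerivAt (fun s : ℝ => (segProd dims (arr (θ + s • u)) 0 n - Λ) i k)
      (segDeriv dims (arr θ) (arr u) n i k) 0 := by
    intro i k
    have h := hasDerivAt_segProd (hasDerivAt_arr_line (arr := arr) θ u) le_rfl i k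
    rw [zero_smul, add_zero] at h
    exact h.sub_const (Λ i k)
  have h3 := ((hasDerivAt_frobInner hP hP).const_mul (1 / 2)).add_const c
  rw [zero_smul, add_zero, frobInner_comm (segDeriv _ _ _ _)] at h3
  have e : (f ∘ fun s : ℝ => θ + s • u) = fun s : ℝ =>
      1 / 2 * frobInner (segProd dims (arr (θ + s • u)) 0 n - Λ)
        (segProd dims (arr (θ + s • u)) 0 n - Λ) + c := by
    ext s
    simp only [Function.comp_apply, hf, frobInner_self]
  rw [e] at h2
  rw [h1, h2.unique h3]
  ring

lemma differentiable_gradient_loss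
    (hf : ∀ θ, f θ = 1 / 2 * frobNorm (segProd dims (arr θ) 0 n - Λ) ^ 2 + c) :
    Differentiable ℝ (gradient f) := by
  rw [differentiable_euclidean]
  intro i
  have e : (fun θ => gradient f θ i) = fun θ => fderiv ℝ f θ (EuclideanSpace.single i 1) := by
    ext θ
    have : ⟪gradient f θ, EuclideanSpace.single i 1⟫ = fderiv ℝ f θ (EuclideanSpace.single i 1) :=
      InnerProductSpace.toDual_symm_apply
    rw [← this, EuclideanSpace.inner_single_right]
    simp
  rw [e]
  exact (((contDiff_loss hf).fderiv_right (m := 1) (by norm_num)).differentiable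
    (by norm_num)).clm_apply (differentiable_const _)

lemma inner_fderiv_gradient_loss
    (hf : ∀ θ, f θ = 1 / 2 * frobNorm (segProd dims (arr θ) 0 n - Λ) ^ 2 + c)
    (θ u v : EuclideanSpace ℝ (Fin d)) :
    ⟪fderiv ℝ (gradient f) θ v, u⟫ =
      frobInner (segDeriv dims (arr θ) (arr v) n) (segDeriv dims (arr θ) (arr u) n) +
        frobInner (segProd dims (arr θ) 0 n - Λ) (segDeriv₂ dims (arr θ) (arr u) (arr v) n) := by
  have hd : HasFDerivAt (gradient f) (fderiv ℝ (gradient f) θ) (θ + (0 : ℝ) • v) := by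
    rw [zero_smul, add_zero]
    exact (differentiable_gradient_loss hf θ).hasFDerivAt
  have h2 := (hd.comp_hasDerivAt (0 : ℝ) (hasDerivAt_line θ v)).inner ℝ (hasDerivAt_const (0 : ℝ) u)
  have hP : ∀ i k, HasDerivAt (fun s : ℝ => (segProd dims (arr (θ + s • v)) 0 n - Λ) i k)
      (segDeriv dims (arr θ) (arr v) n i k) 0 := by
    intro i k
    have h := hasDerivAt_segProd (hasDerivAt_arr_line (arr := arr) θ v) le_rfl i k
    rw [zero_smul, add_zero] at h
    exact h.sub_const (Λ i k)
  have hD : ∀ i k, HasDerivAt (fun s : ℝ => segDeriv dims (arr (θ + s • v)) (arr u) n i k)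
      (segDeriv₂ dims (arr θ) (arr u) (arr v) n i k) 0 := by
    intro i k
    have h := hasDerivAt_segDeriv (U := arr u) (hasDerivAt_arr_line (arr := arr) θ v) le_rfl i k
    rwa [zero_smul, add_zero] at h
  have h3 := hasDerivAt_frobInner hP hD
  rw [zero_smul, add_zero] at h3
  have e : (fun s : ℝ => ⟪(gradient f ∘ fun s : ℝ => θ + s • v) s, u⟫) = fun s : ℝ =>
      frobInner (segProd dims (arr (θ + s • v)) 0 n - Λ)
        (segDeriv dims (arr (θ + s • v)) (arr u) n) := by
    ext s
    rw [Function.comp_apply, inner_gradient_loss hf]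
  rw [e] at h2
  have := h2.unique h3
  rwa [inner_zero_right, zero_add] at this

/-! ### Norm estimates in parameter space -/

section NormEstimates

variable (hinner : ∀ u v : EuclideanSpace ℝ (Fin d), ⟪u, v⟫ =
      ∑ j : Fin n, ∑ p : Fin (dims (j.val + 1)), ∑ q : Fin (dims j.val),
        arr u j p q * arr v j p q)
include hinner

lemma sum_layerNorm_sq (u : EuclideanSpace ℝ (Fin d)) :
    ∑ j ∈ Finset.range n, layerNorm (arr u) j ^ 2 = ‖u‖ ^ 2 := by
  rw [sum_range_layerNorm (arr u) (fun x => x ^ 2), ← real_inner_self_eq_norm_sq, hinner]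
  simp only [frobNorm_sq]
  simp only [sq]

lemma frobNorm_arr_le (u : EuclideanSpace ℝ (Fin d)) (j : Fin n) : frobNorm (arr u j) ≤ ‖u‖ := by
  refine le_of_sq_le_sq ?_ (norm_nonneg u)
  rw [← sum_layerNorm_sq hinner, sum_range_layerNorm (arr u) (fun x => x ^ 2)]
  exact Finset.single_le_sum (f := fun j => frobNorm (arr u j) ^ 2) (fun _ _ => sq_nonneg _)
    (Finset.mem_univ j)

lemma sum_layerNorm_le (u : EuclideanSpace ℝ (Fin d)) :
    ∑ j ∈ Finset.range n, layerNorm (arr u) j ≤ √n * ‖u‖ := by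
  refine le_of_sq_le_sq ?_ (by positivity)
  rw [mul_pow, Real.sq_sqrt (Nat.cast_nonneg n), ← sum_layerNorm_sq hinner]
  simpa using sq_sum_le_card_mul_sum_sq (s := Finset.range n) (f := layerNorm (arr u))

lemma frobNorm_segDeriv_le {W : WeightFam n dims} {ρ C : ℝ} (hW : ∀ j, frobNorm (W j) ≤ ρ)
    (hρ : 1 ≤ ρ) (hC : ρ ^ n ≤ C) (u : EuclideanSpace ℝ (Fin d)) :
    frobNorm (segDeriv dims W (arr u) n) ≤ C * (√n * ‖u‖) := by
  have h := mul_frobNorm_segDeriv_le (V := arr u) hW (by linarith) le_rfl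
  have h1 : 0 ≤ ∑ j ∈ Finset.range n, layerNorm (arr u) j :=
    Finset.sum_nonneg fun _ _ => layerNorm_nonneg _ _
  calc _ ≤ ρ * frobNorm (segDeriv dims W (arr u) n) :=
        le_mul_of_one_le_left (frobNorm_nonneg _) hρ
    _ ≤ _ := h
    _ ≤ _ := mul_le_mul hC (sum_layerNorm_le hinner u) h1 (le_trans (by positivity) hC)

lemma frobNorm_segDeriv₂_le {W : WeightFam n dims} {ρ C : ℝ} (hW : ∀ j, frobNorm (W j) ≤ ρ)
    (hρ : 1 ≤ ρ) (hC : ρ ^ n ≤ C) (u v : EuclideanSpace ℝ (Fin d)) :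
    frobNorm (segDeriv₂ dims W (arr u) (arr v) n) ≤ C * (n * (‖u‖ * ‖v‖)) := by
  have h := sq_mul_frobNorm_segDeriv₂_le (U := arr u) (V := arr v) hW (by linarith) le_rfl
  have hu : 0 ≤ ∑ j ∈ Finset.range n, layerNorm (arr u) j :=
    Finset.sum_nonneg fun _ _ => layerNorm_nonneg _ _
  have hv : 0 ≤ ∑ j ∈ Finset.range n, layerNorm (arr v) j :=
    Finset.sum_nonneg fun _ _ => layerNorm_nonneg _ _
  have huv : 0 ≤ ∑ j ∈ Finset.range n, layerNorm (arr u) j * layerNorm (arr v) j :=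
    Finset.sum_nonneg fun _ _ => mul_nonneg (layerNorm_nonneg _ _) (layerNorm_nonneg _ _)
  have hS := mul_le_mul (sum_layerNorm_le hinner u) (sum_layerNorm_le hinner v) hv (by positivity)
  calc _ ≤ ρ ^ 2 * frobNorm (segDeriv₂ dims W (arr u) (arr v) n) :=
        le_mul_of_one_le_left (frobNorm_nonneg _) (one_le_pow₀ hρ)
    _ ≤ _ := h
    _ ≤ ρ ^ n * (√n * ‖u‖ * (√n * ‖v‖)) := by gcongr; linarith
    _ = ρ ^ n * (n * (‖u‖ * ‖v‖)) := by
        linear_combination ρ ^ n * ‖u‖ * ‖v‖ * Real.mul_self_sqrt (Nat.cast_nonneg n)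
    _ ≤ _ := by gcongr

lemma frobNorm_segDeriv₂_self_le (hn : 2 ≤ n) {W : WeightFam n dims} {ρ : ℝ}
    (hW : ∀ j, frobNorm (W j) ≤ ρ) (hρ : 0 < ρ) (v : EuclideanSpace ℝ (Fin d)) :
    frobNorm (segDeriv₂ dims W (arr v) (arr v) n) ≤ ρ ^ (n - 2) * (((n : ℝ) - 1) * ‖v‖ ^ 2) := by
  have h := sq_mul_frobNorm_segDeriv₂_le (U := arr v) (V := arr v) hW hρ.le le_rfl
  simp only [← sq, sum_layerNorm_sq hinner] at h
  have hS := pow_le_pow_left₀ (Finset.sum_nonneg fun j _ => layerNorm_nonneg _ _)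
    (sum_layerNorm_le hinner v) 2
  rw [mul_pow, Real.sq_sqrt (Nat.cast_nonneg n)] at hS
  have e : ρ ^ n = ρ ^ 2 * ρ ^ (n - 2) := by rw [← pow_add]; congr 1; omega
  refine le_of_mul_le_mul_left (h.trans ?_) (by positivity : 0 < ρ ^ 2)
  rw [e, mul_assoc]
  gcongr
  linarith

end NormEstimates

end TrainingLoss

section BallEstimates

variable {n d : ℕ} {dims : ℕ → ℕ} {arr : EuclideanSpace ℝ (Fin d) →ₗ[ℝ] WeightFam n dims}
  {Λ : Matrix (Fin (dims n)) (Fin (dims 0)) ℝ} {f : EuclideanSpace ℝ (Fin d) → ℝ} {c : ℝ}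

lemma frobNorm_arr_le_add (hinner : ∀ u v : EuclideanSpace ℝ (Fin d), ⟪u, v⟫ =
      ∑ j : Fin n, ∑ p : Fin (dims (j.val + 1)), ∑ q : Fin (dims j.val),
        arr u j p q * arr v j p q)
    {θ q : EuclideanSpace ℝ (Fin d)} {ε σ : ℝ} (hq : ‖q - θ‖ ≤ ε)
    (hσ : ∀ j, frobNorm (arr θ j) ≤ σ) (j : Fin n) : frobNorm (arr q j) ≤ σ + ε := by
  have h1 := frobNorm_add_le (arr θ j) (arr (q - θ) j)
  rw [map_sub, Pi.sub_apply, add_sub_cancel, ← Pi.sub_apply, ← map_sub] at h1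
  linarith [hσ j, (frobNorm_arr_le hinner (q - θ) j).trans hq]

variable (hinner : ∀ u v : EuclideanSpace ℝ (Fin d), ⟪u, v⟫ =
      ∑ j : Fin n, ∑ p : Fin (dims (j.val + 1)), ∑ q : Fin (dims j.val),
        arr u j p q * arr v j p q)
  (hf : ∀ θ, f θ = 1 / 2 * frobNorm (segProd dims (arr θ) 0 n - Λ) ^ 2 + c)
  (hΛ : frobNorm Λ = 1)

include hinner hf hΛ

lemma norm_fderiv_gradient_loss_le (hn : n ≠ 0) {q : EuclideanSpace ℝ (Fin d)} {ε : ℝ}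
    (hε : 0 ≤ ε) (hnε : n * ε ≤ 1 / 2) (hq : ∀ j, frobNorm (arr q j) ≤ 1 + ε) :
    ‖fderiv ℝ (gradient f) q‖ ≤ 16 * (n : ℝ) ∧ ‖gradient f q‖ ≤ 6 * √n := by
  have hC := one_add_pow_le hε le_rfl hnε
  have hP : frobNorm (segProd dims (arr q) 0 n - Λ) ≤ 8 / 3 := by
    have h1 := frobNorm_segProd_le hq (by linarith) le_rfl hn
    linarith [frobNorm_sub_le (segProd dims (arr q) 0 n) Λ]
  have hs : √(n : ℝ) * √n = n := Real.mul_self_sqrt (Nat.cast_nonneg n)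
  have hD := fun u => frobNorm_segDeriv_le hinner hq (by linarith) hC u
  constructor
  · refine ContinuousLinearMap.opNorm_le_bound _ (by positivity) fun v => ?_
    set u := fderiv ℝ (gradient f) q v with hu
    have h0 := inner_fderiv_gradient_loss hf q u v
    rw [← hu, real_inner_self_eq_norm_sq] at h0
    have h1 := (le_abs_self _).trans (abs_frobInner_le (segDeriv dims (arr q) (arr v) n)
      (segDeriv dims (arr q) (arr u) n))
    have h2 := (le_abs_self _).trans (abs_frobInner_le (segProd dims (arr q) 0 n - Λ)
      (segDeriv₂ dims (arr q) (arr u) (arr v) n))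
    have h3 := mul_le_mul (hD v) (hD u) (frobNorm_nonneg _) (by positivity)
    have h4 := mul_le_mul hP (frobNorm_segDeriv₂_le hinner hq (by linarith) hC u v)
      (frobNorm_nonneg _) (by norm_num)
    have h5 : ‖u‖ ^ 2 ≤ 65 / 9 * n * ‖v‖ * ‖u‖ := by
      have e : 5 / 3 * (√(n : ℝ) * ‖v‖) * (5 / 3 * (√(n : ℝ) * ‖u‖)) =
          25 / 9 * n * ‖v‖ * ‖u‖ := by
        linear_combination 25 / 9 * ‖v‖ * ‖u‖ * hs
      linarith
    rcases (norm_nonneg u).eq_or_lt with h | h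
    · rw [← h]; positivity
    · have h6 : ‖u‖ ≤ 65 / 9 * n * ‖v‖ :=
        le_of_mul_le_mul_right (by linarith) h
      have : 0 ≤ n * ‖v‖ := by positivity
      linarith
  · set u := gradient f q with hu
    have h0 := inner_gradient_loss hf q u
    rw [← hu, real_inner_self_eq_norm_sq] at h0
    have h1 := (le_abs_self _).trans (abs_frobInner_le (segProd dims (arr q) 0 n - Λ)
      (segDeriv dims (arr q) (arr u) n))
    have h2 := mul_le_mul hP (hD u) (frobNorm_nonneg _) (by norm_num)
    rcases (norm_nonneg u).eq_or_lt with h | h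
    · rw [← h]; positivity
    · have h6 : ‖u‖ ≤ 40 / 9 * √n := le_of_mul_le_mul_right (by linarith) h
      have : 0 ≤ √(n : ℝ) := Real.sqrt_nonneg _
      linarith

lemma neg_le_hessQ_loss (hn : 2 ≤ n) {θ q : EuclideanSpace ℝ (Fin d)} {ε σ : ℝ}
    (hε : 0 ≤ ε) (hnε : n * ε ≤ 1 / 2) (hσ0 : 0 < σ) (hσ1 : σ ≤ 1)
    (hθ : ∀ j, frobNorm (arr θ j) ≤ σ) (hq : ‖q - θ‖ ≤ ε) (v : EuclideanSpace ℝ (Fin d)) :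
    -(((n : ℝ) - 1) * (frobNorm (segProd dims (arr θ) 0 n - Λ) * σ ^ (n - 2) + 7 * n * ε)) *
      ‖v‖ ^ 2 ≤ hessQ f q v := by
  have hqσ := frobNorm_arr_le_add hinner hq hθ
  have hn1 : (1 : ℝ) ≤ n := by exact_mod_cast (by omega : 1 ≤ n)
  have hnε0 : 0 ≤ n * ε := by positivity
  set D := frobNorm (segProd dims (arr θ) 0 n - Λ) with hD
  have hD0 : 0 ≤ D := frobNorm_nonneg _
  have hD2 : D ≤ 2 := by
    have h1 := frobNorm_segProd_le hθ hσ0.le le_rfl (by omega)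
    have h2 : σ ^ n ≤ 1 := pow_le_one₀ hσ0.le hσ1
    linarith [frobNorm_sub_le (segProd dims (arr θ) 0 n) Λ]
  have hP : frobNorm (segProd dims (arr q) 0 n - Λ) ≤ D + 5 / 3 * (n * ε) := by
    have h1 := frobNorm_segProd_sub_le (W' := arr q) hθ hσ0.le (fun j => by
      rw [← Pi.sub_apply, ← map_sub]
      exact (frobNorm_arr_le hinner (q - θ) j).trans hq) hε le_rfl
    have h2 := add_pow_sub_pow_le hσ0.le hσ1 hε n
    have h3 := mul_le_mul_of_nonneg_left (one_add_pow_le hε le_rfl hnε) hnε0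
    have h4 := frobNorm_add_le (segProd dims (arr q) 0 n - segProd dims (arr θ) 0 n)
      (segProd dims (arr θ) 0 n - Λ)
    rw [sub_add_sub_cancel] at h4
    linarith
  have hY : (σ + ε) ^ (n - 2) ≤ σ ^ (n - 2) + 5 / 3 * (n * ε) := by
    have h2 := add_pow_sub_pow_le hσ0.le hσ1 hε (n - 2)
    have h4 : ((n - 2 : ℕ) : ℝ) * ε ≤ n * ε := by gcongr; omega
    have h3 := mul_le_mul h4 (one_add_pow_le hε (Nat.sub_le n 2) hnε) (by positivity) hnε0
    linarith
  have hY1 : (σ + ε) ^ (n - 2) ≤ 5 / 3 :=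
    (pow_le_pow_left₀ (by linarith) (by linarith) _).trans
      (one_add_pow_le hε (Nat.sub_le n 2) hnε)
  have hB := frobNorm_segDeriv₂_self_le hinner hn hqσ (by linarith) v
  have hH : hessQ f q v = frobNorm (segDeriv dims (arr q) (arr v) n) ^ 2 +
      frobInner (segProd dims (arr q) 0 n - Λ) (segDeriv₂ dims (arr q) (arr v) (arr v) n) := by
    rw [hessQ, real_inner_comm, inner_fderiv_gradient_loss hf, frobInner_self]
  have h1 := (neg_le_abs _).trans (abs_frobInner_le (segProd dims (arr q) 0 n - Λ)
      (segDeriv₂ dims (arr q) (arr v) (arr v) n))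
  have hY0 : 0 ≤ (σ + ε) ^ (n - 2) := by positivity
  have hXY : frobNorm (segProd dims (arr q) 0 n - Λ) * (σ + ε) ^ (n - 2) ≤
      D * σ ^ (n - 2) + 7 * n * ε := by
    have a1 := mul_le_mul_of_nonneg_right hP hY0
    have a2 := mul_le_mul_of_nonneg_left hY hD0
    have a3 := mul_le_mul_of_nonneg_right hD2 (by positivity : 0 ≤ 5 / 3 * (n * ε))
    have a4 := mul_le_mul_of_nonneg_left hY1 (by positivity : 0 ≤ 5 / 3 * (n * ε))
    linarith
  have hV : 0 ≤ ((n : ℝ) - 1) * ‖v‖ ^ 2 := mul_nonneg (by linarith) (sq_nonneg _)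
  have h2 := mul_le_mul_of_nonneg_left hB (frobNorm_nonneg (segProd dims (arr q) 0 n - Λ))
  have h3 := mul_le_mul_of_nonneg_right hXY hV
  have h4 := sq_nonneg (frobNorm (segDeriv dims (arr q) (arr v) n))
  rw [hH]
  linarith

end BallEstimates

section RayTrajectory

variable {d m : ℕ} {dims : ℕ → ℕ}

lemma rayFam_eq_sum (a : ∀ k, Fin (dims k) → ℝ) (s : ℝ) (p : Fin (dims 0) → ℝ) :
    rayFam (m + 1) a s p =
      s • rayFam (m + 1) a 1 0 + ∑ i, p i • rayFam (m + 1) a 0 (Pi.single i 1) := by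
  funext ⟨j, hj⟩
  simp only [Pi.add_apply, Pi.smul_apply, Finset.sum_apply]
  cases j with
  | zero =>
    simp only [rayFam_zero]
    ext k l
    simp [vecMulVec_apply, Matrix.sum_apply, Pi.single_apply, mul_comm]
  | succ j =>
    simp only [rayFam_succ]
    simp

lemma hasDerivAt_symm_rayFam (e : EuclideanSpace ℝ (Fin d) ≃ₗ[ℝ] WeightFam (m + 1) dims)
    (a : ∀ k, Fin (dims k) → ℝ) {s : ℝ → ℝ} {p : ℝ → Fin (dims 0) → ℝ} {s' t : ℝ}
    {p' : Fin (dims 0) → ℝ} (hs : HasDerivAt s s' t) (hp : ∀ i, HasDerivAt (fun x => p x i) (p' i) t) :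
    HasDerivAt (fun x => e.symm (rayFam (m + 1) a (s x) (p x)))
      (e.symm (rayFam (m + 1) a s' p')) t := by
  simp only [rayFam_eq_sum a (s _) (p _), rayFam_eq_sum a s' p', map_add, map_sum, map_smul]
  exact (hs.smul_const _).add (HasDerivAt.fun_sum fun i _ => (hp i).smul_const _)

variable {e : EuclideanSpace ℝ (Fin d) ≃ₗ[ℝ] WeightFam (m + 1) dims}
  {Λ : Matrix (Fin (dims (m + 1))) (Fin (dims 0)) ℝ} {f : EuclideanSpace ℝ (Fin d) → ℝ} {c : ℝ}
  {a : ∀ k, Fin (dims k) → ℝ} {s : ℝ} {u : Fin (dims 0) → ℝ}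

lemma one_vecMul_segProd_rayFam_sub (ha : ∀ k, k ≠ 0 → k ≤ m + 1 → a k ⬝ᵥ a k = 1)
    (ha1 : a (m + 1) = 1) :
    (1 : Fin (dims (m + 1)) → ℝ) ᵥ* (segProd dims (rayFam (m + 1) a s (s • u)) 0 (m + 1) - Λ) =
      s ^ (m + 1) • u - 1 ᵥ* Λ := by
  rw [Matrix.vecMul_sub, segProd_rayFam ha (Nat.lt_succ_self m), Matrix.vecMul_smul,
    Matrix.vecMul_vecMulVec, ← ha1, ha (m + 1) m.succ_ne_zero le_rfl, one_smul, smul_smul, pow_succ]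

lemma frobNorm_segProd_rayFam_sub_sq [Unique (Fin (dims (m + 1)))]
    (ha : ∀ k, k ≠ 0 → k ≤ m + 1 → a k ⬝ᵥ a k = 1)
    (ha1 : a (m + 1) = 1) (hu : u ⬝ᵥ u = 1) (hΛ : frobNorm Λ = 1) :
    frobNorm (segProd dims (rayFam (m + 1) a s (s • u)) 0 (m + 1) - Λ) ^ 2 =
      sqDist (s ^ (m + 1)) ((1 ᵥ* Λ) ⬝ᵥ u) := by
  have hl : (1 ᵥ* Λ) ⬝ᵥ (1 ᵥ* Λ) = 1 := by
    rw [← frobInner_eq_of_unique, frobInner_self, hΛ, one_pow]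
  rw [← frobInner_self, frobInner_eq_of_unique, one_vecMul_segProd_rayFam_sub ha ha1, sqDist]
  simp only [sub_dotProduct, dotProduct_sub, smul_dotProduct, dotProduct_smul, hu, hl, smul_eq_mul,
    dotProduct_comm u (1 ᵥ* Λ)]
  ring

lemma neg_gradient_loss_symm_rayFam [Unique (Fin (dims (m + 1)))]
    (hinner : ∀ u v : EuclideanSpace ℝ (Fin d), ⟪u, v⟫ =
      ∑ j : Fin (m + 1), ∑ p : Fin (dims (j.val + 1)), ∑ q : Fin (dims j.val),
        e u j p q * e v j p q)
    (hf : ∀ θ, f θ = 1 / 2 * frobNorm (segProd dims (e θ) 0 (m + 1) - Λ) ^ 2 + c)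
    (ha : ∀ k, k ≠ 0 → k ≤ m + 1 → a k ⬝ᵥ a k = 1) (ha1 : a (m + 1) = 1) (hu : u ⬝ᵥ u = 1) :
    e.symm (rayFam (m + 1) a (s ^ m * ((1 ᵥ* Λ) ⬝ᵥ u - s ^ (m + 1)))
      (s ^ m • (1 ᵥ* Λ - s ^ (m + 1) • u))) =
      -gradient f (e.symm (rayFam (m + 1) a s (s • u))) := by
  refine ext_inner_right ℝ fun w => ?_
  have h1 := inner_gradient_loss (arr := e.toLinearMap) hf (e.symm (rayFam (m + 1) a s (s • u))) w
  rw [inner_neg_left, h1, real_inner_comm, hinner]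
  simp only [LinearEquiv.coe_coe, LinearEquiv.apply_symm_apply]
  change ∑ j, frobInner (e w j) (rayFam _ _ _ _ j) = _
  rw [sum_frobInner_rayFam, frobInner_eq_of_unique, one_vecMul_segProd_rayFam_sub ha ha1]
  nth_rewrite 4 [← ha1]
  rw [vecMul_segDeriv_rayFam ha _ (Nat.lt_succ_self m)]
  set l := (1 : Fin (dims (m + 1)) → ℝ) ᵥ* Λ
  set b := a (0 + 1) ᵥ* e w ⟨0, m.succ_pos⟩
  simp only [sub_dotProduct, dotProduct_sub, smul_dotProduct, dotProduct_smul, dotProduct_add, hu,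
    smul_eq_mul, dotProduct_comm b l, dotProduct_comm b u]
  ring

lemma dotProduct_flow_self {q : ℕ} {l x : Fin q → ℝ} {ν : ℝ} (h1 : -1 < ν) (h2 : ν ≤ 1)
    (hl : l ⬝ᵥ l = 1) (hx : x ⬝ᵥ x = 1) (hν : ν = l ⬝ᵥ x) (y : ℝ) :
    ((flowCosh ν y)⁻¹ • (x + (flowSinh ν y - ν) • l)) ⬝ᵥ
      ((flowCosh ν y)⁻¹ • (x + (flowSinh ν y - ν) • l)) = 1 := by
  have h0 := (flowCosh_pos h1 h2 y).ne'
  have h3 := flowCosh_sq_sub ν y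
  simp only [smul_dotProduct, dotProduct_smul, add_dotProduct, dotProduct_add, hl, hx,
    dotProduct_comm x l, ← hν, smul_eq_mul]
  field_simp
  linarith

lemma dotProduct_flow {q : ℕ} {l x : Fin q → ℝ} {ν : ℝ} (hl : l ⬝ᵥ l = 1) (hν : ν = l ⬝ᵥ x)
    (y : ℝ) :
    l ⬝ᵥ ((flowCosh ν y)⁻¹ • (x + (flowSinh ν y - ν) • l)) = flowSinh ν y / flowCosh ν y := by
  simp only [dotProduct_smul, dotProduct_add, hl, ← hν, smul_eq_mul]
  ring

theorem exists_gradientFlow_of_radial {k : ℕ}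
    {e : EuclideanSpace ℝ (Fin d) ≃ₗ[ℝ] WeightFam (k + 2) dims}
    {Λ : Matrix (Fin (dims (k + 2))) (Fin (dims 0)) ℝ} {f : EuclideanSpace ℝ (Fin d) → ℝ}
    {c ν : ℝ} {a : ∀ k, Fin (dims k) → ℝ} [Unique (Fin (dims (k + 2)))]
    (hinner : ∀ u v : EuclideanSpace ℝ (Fin d), ⟪u, v⟫ =
      ∑ j : Fin (k + 2), ∑ p : Fin (dims (j.val + 1)), ∑ q : Fin (dims j.val),
        e u j p q * e v j p q)
    (hf : ∀ θ, f θ = 1 / 2 * frobNorm (segProd dims (e θ) 0 (k + 2) - Λ) ^ 2 + c)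
    (ha : ∀ i ≤ k + 2, a i ⬝ᵥ a i = 1) (ha1 : a (k + 2) = 1) (hΛ : frobNorm Λ = 1)
    (h1 : -1 < ν) (h2 : ν ≤ 1) (hν : ν = (1 ᵥ* Λ) ⬝ᵥ a 0) {τ σ : ℝ → ℝ} (hτ0 : τ 0 = 0)
    (hflow : ∀ t ≥ 0, 0 < σ t ∧ σ t ≤ 1 ∧ HasDerivAt τ (σ t ^ k) t ∧
        HasDerivAt σ (σ t ^ (k + 1) *
          (flowSinh ν (τ t) / flowCosh ν (τ t) - σ t ^ (k + 2))) t) :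
    ∃ θ : ℝ → EuclideanSpace ℝ (Fin d),
      θ 0 = e.symm (rayFam (k + 2) a (σ 0) (σ 0 • a 0)) ∧
      ∀ t ≥ 0, HasDerivAt θ (-gradient f (θ t)) t ∧ (∀ j, frobNorm (e (θ t) j) ≤ σ t) ∧
        frobNorm (segProd dims (e (θ t)) 0 (k + 2) - Λ) ^ 2 =
          sqDist (σ t ^ (k + 2)) (flowSinh ν (τ t) / flowCosh ν (τ t)) := by
  set l := (1 : Fin (dims (k + 2)) → ℝ) ᵥ* Λ with hl
  have hll : l ⬝ᵥ l = 1 := by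
    rw [hl, ← frobInner_eq_of_unique, frobInner_self, hΛ, one_pow]
  have ha' : ∀ i, i ≠ 0 → i ≤ k + 2 → a i ⬝ᵥ a i = 1 := fun i _ hi => ha i hi
  let u : ℝ → Fin (dims 0) → ℝ := fun t =>
    (flowCosh ν (τ t))⁻¹ • (a 0 + (flowSinh ν (τ t) - ν) • l)
  have huu : ∀ t, u t ⬝ᵥ u t = 1 := fun t =>
    dotProduct_flow_self h1 h2 hll (ha 0 (Nat.zero_le _)) hν (τ t)
  have hlu : ∀ t, l ⬝ᵥ u t = flowSinh ν (τ t) / flowCosh ν (τ t) := fun t =>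
    dotProduct_flow hll hν (τ t)
  refine ⟨fun t => e.symm (rayFam (k + 2) a (σ t) (σ t • u t)), ?_, fun t ht => ?_⟩
  · simp [u, hτ0, flowCosh_zero, flowSinh_zero]
  · obtain ⟨hσ0, -, hdτ, hdσ⟩ := hflow t ht
    have hC := (flowCosh_pos h1 h2 (τ t)).ne'
    have hp : ∀ i, HasDerivAt (fun x => (σ x • u x) i)
        ((σ t ^ (k + 1) • (l - σ t ^ (k + 2) • u t)) i) t := by
      intro i
      have d1 := ((hasDerivAt_flowCosh ν (τ t)).comp t hdτ).inv hC
      have d2 := (((hasDerivAt_flowSinh ν (τ t)).comp t hdτ).sub_const ν).mul_const (l i)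
      refine (hdσ.mul (d1.mul (d2.const_add (a 0 i)))).congr_deriv ?_
      simp only [u, Pi.smul_apply, Pi.sub_apply, Pi.add_apply, smul_eq_mul, Function.comp_apply,
        Pi.inv_apply, Pi.mul_apply]
      field_simp
      ring
    have hg := neg_gradient_loss_symm_rayFam (m := k + 1) (s := σ t) hinner hf ha' ha1 (huu t)
    rw [← hl, hlu] at hg
    refine ⟨(hasDerivAt_symm_rayFam (m := k + 1) e a hdσ hp).congr_deriv hg, fun j => ?_, ?_⟩
    · rw [e.apply_symm_apply]
      exact (frobNorm_rayFam hσ0.le ha' (huu t) j).le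
    · rw [e.apply_symm_apply, frobNorm_segProd_rayFam_sub_sq (m := k + 1) ha' ha1 (huu t) hΛ,
        ← hl, hlu]

end RayTrajectory

open MeasureTheory in
/-- Proposition 3 of the paper: analysis of gradient flow over the
square-loss training loss of a deep linear network with scalar output, starting from a
balanced initialization of small positive norm: the trajectory exists for infinite time,
converges to `ε'`-optimality by an explicit time, and enjoys explicit smoothness,
Lipschitz and curvature bounds in an `ε`-neighborhood of the trajectory. -/
theorem deep_linear_gradient_flow_analysis {n d : ℕ} (hn : 2 ≤ n)
    (dims : ℕ → ℕ) (hdn : dims n = 1)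
    (Lyx : Matrix (Fin (dims n)) (Fin (dims 0)) ℝ) (hLyx : frobNorm Lyx = 1)
    (arr : EuclideanSpace ℝ (Fin d) →ₗ[ℝ] WeightFam n dims)
    (harr : Function.Bijective arr)
    (hinner : ∀ u v : EuclideanSpace ℝ (Fin d), ⟪u, v⟫ =
      ∑ j : Fin n, ∑ p : Fin (dims (j.val + 1)), ∑ q : Fin (dims j.val),
        arr u j p q * arr v j p q)
    (f : EuclideanSpace ℝ (Fin d) → ℝ)
    (hf : ∀ θ', f θ' =
      1 / 2 * frobNorm (segProd dims (arr θ') 0 n - Lyx) ^ 2 + sInf (Set.range f))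
    (θs : EuclideanSpace ℝ (Fin d)) (hbal : IsBalanced dims (arr θs))
    (W0 : Matrix (Fin (dims n)) (Fin (dims 0)) ℝ) (hW0 : W0 = segProd dims (arr θs) 0 n)
    (hW0pos : 0 < frobNorm W0) (hW0small : frobNorm W0 ≤ 0.2)
    (ν : ℝ) (hν : ν = Matrix.trace (Lyxᵀ * W0) / (frobNorm Lyx * frobNorm W0))
    (hν1 : ν ≠ -1) :
    ∃ θ : ℝ → EuclideanSpace ℝ (Fin d),
      θ 0 = θs ∧
      (∀ t ∈ Set.Ici (0 : ℝ),
        HasDerivWithinAt θ (-gradient f (θ t)) (Set.Ici (0 : ℝ)) t) ∧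
      (∀ ε' : ℝ, 0 < ε' →
        f (θ (2 * (n : ℝ) * (max 1 (3 / 2 * ((1 - ν) / (1 + ν)))) ^ n / frobNorm W0 *
              Real.log (15 * (n : ℝ) * max 1 ((1 - ν) / (1 + ν)) /
                (frobNorm W0 * min 1 (2 * ε'))))) -
            sInf (Set.range f) ≤ ε') ∧
      (∀ t : ℝ, 0 < t → ∀ ε : ℝ, 0 < ε → ε ≤ 1 / (2 * (n : ℝ)) →
        (∀ t' ∈ Set.Icc (0 : ℝ) t, ∀ q ∈ Metric.closedBall (θ t') ε,
          ‖fderiv ℝ (gradient f) q‖ ≤ 16 * (n : ℝ) ∧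
            ‖gradient f q‖ ≤ 6 * Real.sqrt n) ∧
        ∃ m : ℝ → ℝ,
          (∀ t' ∈ Set.Icc (0 : ℝ) t, 0 ≤ m t') ∧
          IntegrableOn m (Set.Icc (0 : ℝ) t) ∧
          (∀ t' ∈ Set.Icc (0 : ℝ) t, ∀ q ∈ Metric.closedBall (θ t') ε,
            ∀ v : EuclideanSpace ℝ (Fin d), -(m t') * ‖v‖ ^ 2 ≤ hessQ f q v) ∧
          (∫ t' in (0 : ℝ)..t, m t') ≤
            15 * (n : ℝ) ^ 3 * (max 1 (3 / 2 * ((1 - ν) / (1 + ν)))) ^ n * t * ε /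
                frobNorm W0 +
              Real.log ((n : ℝ) ^ 2 *
                  (Real.exp 2 * max 1 ((1 - ν) / (1 + ν))) ^ (5 * ((n : ℝ) - 1) / 2) /
                frobNorm W0 ^ 2)) := by
  obtain ⟨k, rfl⟩ : ∃ k, n = k + 2 := ⟨n - 2, by omega⟩
  set r := frobNorm W0 with hr
  have hn2 : (2 : ℝ) ≤ ((k + 2 : ℕ) : ℝ) := by exact_mod_cast hn
  have : Unique (Fin (dims (k + 2))) := by rw [hdn]; infer_instance
  let e := LinearEquiv.ofBijective arr harr
  have hps : 0 < frobNorm (segProd dims (arr θs) 0 (k + 2)) := by rwa [← hW0]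
  obtain ⟨σ₀, a, hσ₀, ha1, ha, hrays⟩ := exists_rays_of_isBalanced (by omega) hdn hbal hps
  have ha' : ∀ i, i ≠ 0 → i ≤ k + 2 → a i ⬝ᵥ a i = 1 := fun i _ hi => ha i hi
  have hθs : arr θs = rayFam (k + 2) a σ₀ (σ₀ • a 0) := by
    funext ⟨j, hj⟩
    rw [hrays j hj]
    cases j with
    | zero => exact ((rayFam_zero hj).trans (Matrix.vecMulVec_smul _ _ _)).symm
    | succ j => exact (rayFam_succ hj).symm
  have hW : W0 = σ₀ ^ (k + 2) • vecMulVec (a (k + 2)) (a 0) := by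
    rw [hW0, hθs, segProd_rayFam (k := k + 1) ha' (Nat.lt_succ_self (k + 1)), Matrix.vecMulVec_smul,
      smul_smul, ← pow_succ]
  have hrσ : r = σ₀ ^ (k + 2) := by
    rw [hr, hW]
    exact frobNorm_smul_vecMulVec _ (by positivity) (ha _ le_rfl) (ha _ (Nat.zero_le _))
  have htr : Matrix.trace (Lyxᵀ * W0) = frobInner Lyx W0 := by
    simp only [Matrix.trace, Matrix.diag_apply, Matrix.mul_apply, Matrix.transpose_apply, frobInner]
    exact Finset.sum_comm
  rw [htr, hLyx, one_mul] at hν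
  have hνl : ν = (1 ᵥ* Lyx) ⬝ᵥ a 0 := by
    rw [hν, hW, ← Matrix.vecMulVec_smul, frobInner_vecMulVec, ha1, dotProduct_smul, ← hrσ,
      smul_eq_mul, mul_div_cancel_left₀ _ hW0pos.ne']
  have habs : |ν| ≤ 1 := by
    rw [hν, abs_div, abs_of_pos hW0pos, div_le_one hW0pos]
    simpa [hLyx] using abs_frobInner_le Lyx W0
  have hν2 : ν ≤ 1 := (abs_le.1 habs).2
  have hν0 : -1 < ν := lt_of_le_of_ne (abs_le.1 habs).1 hν1.symm
  obtain ⟨τ, σ, hτ0, hσ0, hflow, htime, hcurv⟩ :=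
    exists_radial_flow hn hW0pos (by norm_num at hW0small ⊢; exact hW0small) hν0 hν2
  have hσ00 : σ 0 = σ₀ :=
    (pow_left_inj₀ (hflow 0 le_rfl).1.le hσ₀.le (by omega)).1 (hσ0.trans hrσ)
  obtain ⟨θ, hθ0, hθ⟩ := exists_gradientFlow_of_radial (e := e) (ν := ν) hinner hf ha ha1 hLyx
    hν0 hν2 hνl hτ0 hflow
  have hD : ∀ t ≥ 0, frobNorm (segProd dims (arr (θ t)) 0 (k + 2) - Lyx) =
      √(sqDist (σ t ^ (k + 2)) (flowSinh ν (τ t) / flowCosh ν (τ t))) := fun t ht => by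
    rw [← (hθ t ht).2.2, Real.sqrt_sq (frobNorm_nonneg _)]
    rfl
  refine ⟨θ, ?_, fun t ht => (hθ t ht).1.hasDerivWithinAt, fun ε hε => ?_, fun t ht ε hε hεn => ?_⟩
  · rw [hθ0, hσ00, LinearEquiv.symm_apply_eq]
    exact hθs.symm
  · obtain ⟨ht0, ht⟩ := htime ε hε
    have h := ht _ rfl
    rw [← (hθ _ ht0).2.2] at h
    rw [hf]
    change frobNorm (segProd dims (arr (θ _)) 0 (k + 2) - Lyx) ^ 2 ≤ _ at h
    linarith
  have hnε : ((k + 2 : ℕ) : ℝ) * ε ≤ 1 / 2 := by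
    rw [le_div_iff₀ (by positivity)] at hεn
    linarith
  refine ⟨fun s hs q hq => ?_, ?_⟩
  · have hq' : ‖q - θ s‖ ≤ ε := mem_closedBall_iff_norm.1 hq
    refine norm_fderiv_gradient_loss_le hinner hf hLyx (by omega) hε.le hnε fun j => ?_
    exact (frobNorm_arr_le_add hinner hq' (hθ s hs.1).2.1 j).trans
      (by linarith [(hflow s hs.1).2.1])
  set R : ℝ → ℝ := fun s =>
    √(sqDist (σ s ^ (k + 2)) (flowSinh ν (τ s) / flowCosh ν (τ s))) * σ s ^ (k + 2 - 2) with hR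
  have hRc : ContinuousOn R (Set.Icc 0 t) := by
    have hτc : ContinuousOn τ (Set.Icc 0 t) := fun s hs =>
      (hflow s hs.1).2.2.1.continuousAt.continuousWithinAt
    have hσc : ContinuousOn σ (Set.Icc 0 t) := fun s hs =>
      (hflow s hs.1).2.2.2.continuousAt.continuousWithinAt
    have hsinh : Continuous (flowSinh ν) :=
      continuous_iff_continuousAt.2 fun y => (hasDerivAt_flowSinh ν y).continuousAt
    have hq := (hsinh.comp_continuousOn hτc).div ((continuous_flowCosh ν).comp_continuousOn hτc)
      fun s _ => (flowCosh_pos hν0 hν2 _).ne'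
    refine (ContinuousOn.sqrt ?_).mul (hσc.pow _)
    exact (((hσc.pow _).pow 2).sub ((continuousOn_const.mul (hσc.pow _)).mul hq)).add
      continuousOn_const
  have hmc : ContinuousOn (fun s => (((k + 2 : ℕ) : ℝ) - 1) * (R s + 7 * ((k + 2 : ℕ) : ℝ) * ε))
      (Set.Icc 0 t) := continuousOn_const.mul (hRc.add continuousOn_const)
  refine ⟨_, fun s hs => ?_, hmc.integrableOn_Icc, fun s hs q hq v => ?_, ?_⟩
  · have := (hflow s hs.1).1
    have : 0 ≤ R s := by positivity
    exact mul_nonneg (by linarith) (by positivity)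
  · have hq' : ‖q - θ s‖ ≤ ε := mem_closedBall_iff_norm.1 hq
    have h := neg_le_hessQ_loss hinner hf hLyx hn hε.le hnε (hflow s hs.1).1 (hflow s hs.1).2.1
      (hθ s hs.1).2.1 hq' v
    rwa [hD s hs.1] at h
  · have hRi : IntervalIntegrable R volume 0 t :=
      ContinuousOn.intervalIntegrable (by rwa [Set.uIcc_of_le ht.le])
    rw [intervalIntegral.integral_const_mul, intervalIntegral.integral_add hRi
      intervalIntegrable_const, intervalIntegral.integral_const, mul_add, sub_zero, smul_eq_mul]
    refine (add_comm _ _).le.trans (add_le_add ?_ (hcurv t ht.le))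
    set N : ℝ := ((k + 2 : ℕ) : ℝ)
    have hM : (1 : ℝ) ≤ max 1 (3 / 2 * ((1 - ν) / (1 + ν))) ^ (k + 2) :=
      one_le_pow₀ (le_max_left _ _)
    rw [le_div_iff₀ hW0pos]
    have h1 : (N - 1) * (t * (7 * N * ε)) ≤ 15 * N ^ 3 * t * ε := by
      have : 0 ≤ N * t * ε := by positivity
      have hN := mul_nonneg this (by nlinarith : 0 ≤ 15 * N ^ 2 - 7 * (N - 1))
      linarith
    calc (N - 1) * (t * (7 * N * ε)) * r ≤ (N - 1) * (t * (7 * N * ε)) * 1 := by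
          have : 0 ≤ N - 1 := by linarith
          gcongr
          norm_num at hW0small
          linarith
      _ ≤ 15 * N ^ 3 * t * ε := by rwa [mul_one]
      _ ≤ 15 * N ^ 3 * t * ε * max 1 (3 / 2 * ((1 - ν) / (1 + ν))) ^ (k + 2) :=
          le_mul_of_one_le_right (by positivity) hM
      _ = _ := by ring
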